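/- Positive answer to the Burnside problem for the plane Cremona group: every finitely generated torsion subgroup of Bir(ℙ²_ℂ) = Aut_ℂ(ℂ(x,y)) is finite. -/

import Mathlib

set_option autoImplicit false

noncomputable section

/-- The field `ℂ(x,y)` of rational functions in two variables over `ℂ`. -/
abbrev K2 : Type := FractionRing (MvPolynomial (Fin 2) ℂ)

/-- The plane Cremona group `Bir(ℙ²_ℂ)`, identified with the group `Aut_ℂ(ℂ(x,y))`
of `ℂ`-algebra automorphisms of `ℂ(x,y)`. -/
abbrev Cremona2 : Type := K2 ≃ₐ[ℂ] K2

/-- The coordinate function `x`. -/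
def X0 : K2 := algebraMap (MvPolynomial (Fin 2) ℂ) K2 (MvPolynomial.X 0)

/-- The coordinate function `y`. -/
def X1 : K2 := algebraMap (MvPolynomial (Fin 2) ℂ) K2 (MvPolynomial.X 1)

section Combinatorics

open Relation

theorem exists_injective_path_of_infinite {α : Type*} (r : α → α → Prop)
    (hr : ∀ a, {b | r a b}.Finite) (a : α) (ha : {b | ReflTransGen r a b}.Infinite) :
    ∃ f : ℕ → α, f 0 = a ∧ Function.Injective f ∧ ∀ n, r (f n) (f (n + 1)) := by
  classical
  have key : ∀ (F : Set α) (x y : α), ReflTransGen (fun u v => r u v ∧ v ∉ F) x y →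
      y = x ∨ ∃ z, (r x z ∧ z ∉ F) ∧ ReflTransGen (fun u v => r u v ∧ v ∉ insert z F) z y := by
    intro F x y h
    induction h with
    | refl => exact Or.inl rfl
    | @tail y w _ hw ih =>
      right
      rcases ih with rfl | ⟨z, hz, hzy⟩
      · exact ⟨w, hw, ReflTransGen.refl⟩
      · refine ⟨z, hz, ?_⟩
        by_cases hwz : w = z
        · rw [hwz]
        · exact hzy.tail ⟨hw.1, by simp [hwz, hw.2]⟩
  let State := {p : Set α × α // p.2 ∈ p.1 ∧
    {y | ReflTransGen (fun u v => r u v ∧ v ∉ p.1) p.2 y}.Infinite}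
  have step : ∀ p : State, ∃ q : State, r p.1.2 q.1.2 ∧ q.1.2 ∉ p.1.1 ∧ p.1.1 ⊆ q.1.1 := by
    rintro ⟨⟨F, x⟩, hx, hinf⟩
    by_contra! hcon
    apply hinf
    have hsub : {y | ReflTransGen (fun u v => r u v ∧ v ∉ F) x y} ⊆ {x} ∪
        ⋃ z ∈ {z | r x z}, {y | z ∉ F ∧ ReflTransGen (fun u v => r u v ∧ v ∉ insert z F) z y} := by
      intro y hy
      rcases key F x y hy with rfl | ⟨z, hz, hzy⟩
      · simp
      · right
        simp only [Set.mem_iUnion]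
        exact ⟨z, hz.1, hz.2, hzy⟩
    refine Set.Finite.subset ((Set.finite_singleton x).union ((hr x).biUnion fun z hz => ?_)) hsub
    by_contra hz'
    have hzF : z ∉ F := by
      intro h
      apply hz'
      simp [h]
    refine hcon ⟨⟨insert z F, z⟩, by simp, fun h => hz' (h.subset fun y hy => hy.2)⟩ hz hzF ?_
    simp
  choose next hnext using step
  have h0 : {y | ReflTransGen (fun u v => r u v ∧ v ∉ ({a} : Set α)) a y}.Infinite := by
    intro hfin
    apply ha
    refine hfin.subset fun y hy => ?_
    induction hy with
    | refl => exact ReflTransGen.refl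
    | @tail y w _ hw ih =>
      by_cases hwa : w = a
      · rw [hwa]; exact ReflTransGen.refl
      · exact ReflTransGen.tail ih ⟨hw, by simpa using hwa⟩
  let s : ℕ → State := fun n => Nat.rec ⟨⟨{a}, a⟩, by simp, h0⟩ (fun _ p => next p) n
  have hs : ∀ n, s (n + 1) = next (s n) := fun n => rfl
  have hmono : Monotone fun n => (s n).1.1 :=
    monotone_nat_of_le_succ fun n => by rw [hs]; exact (hnext _).2.2
  refine ⟨fun n => (s n).1.2, rfl, ?_, fun n => (hnext (s n)).1⟩
  refine Function.Injective.of_lt_imp_ne fun m n hmn heq => ?_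
  obtain ⟨n, rfl⟩ : ∃ k, n = k + 1 := ⟨n - 1, by omega⟩
  have h1 : (s m).1.2 ∈ (s n).1.1 := hmono (by omega : m ≤ n) (s m).2.1
  have h2 := (hnext (s n)).2.1
  rw [← hs] at h2
  exact h2 (heq ▸ h1)

/-- The ladder argument: an infinite injective path inside the complement `U` of a finite lower part
of a finitely branching forest forces some group element to move a point strictly upwards. -/
theorem exists_lt_smul_of_path {α G : Type*} [PartialOrder α] [Group G] [MulAction G α]
    (hmono : ∀ (g : G) (a b : α), a ≤ b → g • a ≤ g • b)
    (M D : Set α) (hup : IsUpperSet M) (hD : D.Finite)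
    (hDlow : ∀ a ∈ M, ∀ b ∈ D, a ≤ b → a ∈ D)
    (hfin : ∀ b ∈ M, {a ∈ M | a ≤ b}.Finite)
    (hchain : ∀ b ∈ M, ∀ a ∈ M, ∀ c ∈ M, a ≤ b → c ≤ b → a ≤ c ∨ c ≤ a)
    (hlev : ∀ n, {b ∈ M | {a ∈ M | a ≤ b}.ncard ≤ n}.Finite)
    (f : ℕ → α) (hfU : ∀ n, f n ∈ M \ D) (hf : Function.Injective f)
    (t : ℕ → G) (ht : ∀ n, f (n + 1) = t n • f n)
    (htD : ∀ n, ∀ a ∈ M \ D, t n • a ∈ M) :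
    ∃ (g : G) (a : α), a < g • a := by
  classical
  let U := M \ D
  let L : α → Set α := fun b => {a ∈ U | a ≤ b}
  have hLfin : ∀ b ∈ M, (L b).Finite := fun b hb => (hfin b hb).subset fun a ha => ⟨ha.1.1, ha.2⟩
  have hlevU : ∀ n, {b ∈ M | (L b).ncard ≤ n}.Finite := by
    intro n
    refine (hlev (n + D.ncard)).subset fun b hb => ⟨hb.1, ?_⟩
    have : {a ∈ M | a ≤ b} ⊆ L b ∪ D := by
      intro a ha
      by_cases h : a ∈ D
      · exact Or.inr h
      · exact Or.inl ⟨⟨ha.1, h⟩, ha.2⟩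
    calc _ ≤ (L b ∪ D).ncard := Set.ncard_le_ncard this ((hLfin b hb.1).union hD)
      _ ≤ (L b).ncard + D.ncard := Set.ncard_union_le _ _
      _ ≤ _ := by have := hb.2; omega
  let h : ℕ → ℕ := fun n => (L (f n)).ncard
  have hbound : ∀ v, ∃ N, ∀ n ≥ N, v < h n := by
    intro v
    have : {n | h n ≤ v}.Finite :=
      Set.Finite.of_finite_image ((hlevU v).subset (by
        rintro _ ⟨n, hn, rfl⟩
        exact ⟨(hfU n).1, hn⟩)) hf.injOn
    obtain ⟨N, hN⟩ := this.bddAbove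
    refine ⟨N + 1, fun n hn => ?_⟩
    by_contra hcon
    have := hN (show n ∈ {n | h n ≤ v} from not_lt.mp hcon)
    omega
  have hmin : ∀ n, ∃ a, a ∈ L (f n) ∧ ∀ c ∈ L (f n), a ≤ c := by
    intro n
    obtain ⟨a, ha⟩ := (hLfin _ (hfU n).1).exists_minimal ⟨f n, hfU n, le_rfl⟩
    refine ⟨a, ha.1, fun c hc => ?_⟩
    rcases hchain (f n) (hfU n).1 a ha.1.1.1 c hc.1.1 ha.1.2 hc.2 with h1 | h1
    · exact h1
    · exact ha.2 hc h1
  choose m hmL hmle using hmin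
  have hmF : ∀ n, m n ∈ {b ∈ M | (L b).ncard ≤ 1} := by
    intro n
    refine ⟨(hmL n).1.1, ?_⟩
    have : L (m n) ⊆ {m n} := fun c hc => by
      have : m n ≤ c := hmle n c ⟨hc.1, hc.2.trans (hmL n).2⟩
      exact le_antisymm hc.2 this
    simpa using Set.ncard_le_ncard this
  have hladder : ∀ N, ∃ i ≥ N, ∀ j ≥ i, h i ≤ h j := by
    intro N
    obtain ⟨i, hi, hi'⟩ := (measure h).wf.has_min (Set.Ici N) ⟨N, Set.self_mem_Ici⟩
    exact ⟨i, hi, fun j hj => not_lt.mp (hi' j (le_trans hi hj))⟩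
  obtain ⟨i, j, hij, hi, hhij, hmij⟩ : ∃ i j, i ≤ j ∧ (∀ l ≥ i, h i ≤ h l) ∧ h i < h j ∧
      m i = m j := by
    let I : Set ℕ := {i | ∀ j ≥ i, h i ≤ h j}
    have hI : I.Infinite := by
      rw [Set.infinite_iff_exists_gt]
      intro N
      obtain ⟨i, hi, hi'⟩ := hladder (N + 1)
      exact ⟨i, hi', by omega⟩
    obtain ⟨c, hc⟩ : ∃ c, {i ∈ I | m i = c}.Infinite := by
      by_contra! hcon
      refine hI (((hlevU 1).biUnion fun c _ => hcon c).subset fun i hi => ?_)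
      simp only [Set.mem_iUnion]
      exact ⟨m i, hmF i, hi, rfl⟩
    obtain ⟨i, hi⟩ := hc.nonempty
    obtain ⟨N, hN⟩ := hbound (h i)
    obtain ⟨j, hj, hj'⟩ := hc.exists_gt (N + i)
    exact ⟨i, j, by omega, hi.1, hN j (by omega), by rw [hi.2, hj.2]⟩
  have hIcc : ∀ (g : G) (a b : α), (Set.Icc (g • a) (g • b)).ncard = (Set.Icc a b).ncard := by
    intro g a b
    have : Set.Icc (g • a) (g • b) = (fun x => g • x) '' Set.Icc a b := by
      ext x
      constructor
      · intro hx
        refine ⟨g⁻¹ • x, ⟨?_, ?_⟩, by simp⟩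
        · simpa using hmono g⁻¹ _ _ hx.1
        · simpa using hmono g⁻¹ _ _ hx.2
      · rintro ⟨y, hy, rfl⟩
        exact ⟨hmono g _ _ hy.1, hmono g _ _ hy.2⟩
    rw [this, Set.ncard_image_of_injective _ (MulAction.injective g)]
  have hLIcc : ∀ n, Set.Icc (m n) (f n) = L (f n) := by
    intro n
    ext a
    constructor
    · intro ha
      refine ⟨⟨hup ha.1 (hmL n).1.1, fun haD => (hmL n).1.2 ?_⟩, ha.2⟩
      exact hDlow _ (hmL n).1.1 _ haD ha.1
    · intro ha
      exact ⟨hmle n a ha, ha.2⟩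
  have hstep : ∀ n, ∃ g : G, f (i + n) = g • f i ∧ g • m i ∈ U := by
    intro n
    induction n with
    | zero => exact ⟨1, by simp, by simpa using (hmL i).1⟩
    | succ n ih =>
      obtain ⟨g, hg, hgU⟩ := ih
      have hf' : f (i + (n + 1)) = (t (i + n) * g) • f i := by
        rw [← add_assoc, ht, hg, mul_smul]
      refine ⟨t (i + n) * g, hf', ?_⟩
      have hM : (t (i + n) * g) • m i ∈ M := by
        rw [mul_smul]
        exact htD _ _ hgU
      refine ⟨hM, fun hcD => ?_⟩
      set c := (t (i + n) * g) • m i with hc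
      have hcf : c ≤ f (i + (n + 1)) := by
        rw [hf']
        exact hmono _ _ _ (hmL i).2
      have hsub : L (f (i + (n + 1))) ⊂ Set.Icc c (f (i + (n + 1))) := by
        refine (Set.ssubset_iff_of_subset ?_).mpr ⟨c, ⟨le_rfl, hcf⟩, fun h => h.1.2 hcD⟩
        intro a ha
        refine ⟨?_, ha.2⟩
        rcases hchain _ (hfU (i + (n + 1))).1 a ha.1.1 c hM ha.2 hcf with h1 | h1
        · exact absurd (hDlow a ha.1.1 c hcD h1) ha.1.2
        · exact h1
      have hfinI : (Set.Icc c (f (i + (n + 1)))).Finite :=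
        (hfin _ (hfU (i + (n + 1))).1).subset fun a ha => ⟨hup ha.1 hM, ha.2⟩
      have h1 := Set.ncard_lt_ncard hsub hfinI
      rw [hc, hf', hIcc, hLIcc, ← hf'] at h1
      have h2 := hi (i + (n + 1)) (by omega)
      simp only [h] at h2
      omega
  obtain ⟨g, hg, hgU⟩ := hstep (j - i)
  rw [Nat.add_sub_cancel' hij] at hg
  refine ⟨g, m i, lt_of_le_of_ne ?_ fun heq => ?_⟩
  · rw [hmij]
    refine hmle j _ ⟨by rwa [← hmij], ?_⟩
    rw [← hmij, hg]
    exact hmono _ _ _ (hmL i).2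
  · have h1 := hIcc g (m i) (f i)
    rw [← heq, ← hg, hLIcc] at h1
    nth_rewrite 1 [hmij] at h1
    rw [hLIcc] at h1
    simp only [h] at hhij
    omega

theorem exists_finite_orbit {α G : Type*} [PartialOrder α] [Group G] [MulAction G α]
    (hmono : ∀ (g : G) (a b : α), a ≤ b → g • a ≤ g • b)
    (hnot : ∀ (g : G) (a : α), ¬ a < g • a)
    (hG : Group.FG G)
    (M : Set α) (hup : IsUpperSet M) (hinf : M.Infinite)
    (hfin : ∀ b ∈ M, {a ∈ M | a ≤ b}.Finite)
    (hchain : ∀ b ∈ M, ∀ a ∈ M, ∀ c ∈ M, a ≤ b → c ≤ b → a ≤ c ∨ c ≤ a)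
    (hlev : ∀ n, {b ∈ M | {a ∈ M | a ≤ b}.ncard ≤ n}.Finite)
    (hcomm : ∀ g : G, {b ∈ M | g • b ∉ M}.Finite) :
    ∃ b ∈ M, (MulAction.orbit G b).Finite := by
  classical
  obtain ⟨S, hS, hSfin⟩ := Group.fg_iff.mp hG
  let T : Set G := S ∪ S⁻¹
  have hT : T.Finite := hSfin.union hSfin.inv
  let D : Set α := ⋃ g ∈ T, {b ∈ M | g • b ∉ M}
  have hD : D.Finite := hT.biUnion fun g _ => hcomm g
  have hDM : D ⊆ M := by
    intro a ha
    simp only [D, Set.mem_iUnion] at ha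
    obtain ⟨g, -, hg⟩ := ha
    exact hg.1
  have hDT : ∀ a ∈ M \ D, ∀ g ∈ T, g • a ∈ M := by
    intro a ha g hg
    by_contra hcon
    refine ha.2 ?_
    simp only [D, Set.mem_iUnion]
    exact ⟨g, hg, ha.1, hcon⟩
  have hDlow : ∀ a ∈ M, ∀ b ∈ D, a ≤ b → a ∈ D := by
    intro a ha b hb hab
    by_contra hcon
    simp only [D, Set.mem_iUnion] at hb
    obtain ⟨g, hg, hgb⟩ := hb
    exact hgb.2 (hup (hmono g _ _ hab) (hDT a ⟨ha, hcon⟩ g hg))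
  let r : α → α → Prop := fun a b => ∃ g ∈ T, b = g • a ∧ b ∈ M \ D
  have hr : ∀ a, {b | r a b}.Finite := fun a => (hT.image (· • a)).subset (by
    rintro b ⟨g, hg, rfl, -⟩
    exact ⟨g, hg, rfl⟩)
  have hcompfin : ∀ a ∈ M \ D, {b | ReflTransGen r a b}.Finite := by
    intro a ha
    by_contra hcon
    obtain ⟨f, hf0, hfinj, hf⟩ := exists_injective_path_of_infinite r hr a hcon
    choose t htT ht htU using hf
    have hfU : ∀ n, f n ∈ M \ D := by
      intro n
      cases n with
      | zero => rwa [hf0]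
      | succ n => exact htU n
    obtain ⟨g, a, hga⟩ := exists_lt_smul_of_path hmono M D hup hD hDlow hfin hchain hlev f hfU
      hfinj t ht fun n a ha => hDT a ha _ (htT n)
    exact hnot g a hga
  let Y : Set α := ⋃ b ∈ ⋃ g ∈ T, (g • ·) '' D, {c | ReflTransGen r b c ∧ b ∈ M \ D}
  have hY : Y.Finite := by
    refine (hT.biUnion fun g _ => hD.image _).biUnion fun b _ => ?_
    by_cases hb : b ∈ M \ D
    · exact (hcompfin b hb).subset fun c hc => hc.1
    · simp [hb]
  obtain ⟨b, hbM, hb⟩ := (hinf.sdiff (hD.union hY)).nonempty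
  have hbU : b ∈ M \ D := ⟨hbM, fun h => hb (Or.inl h)⟩
  have hbY : b ∉ Y := fun h => hb (Or.inr h)
  have hTinv : ∀ g ∈ T, g⁻¹ ∈ T := by
    rintro g (hg | hg)
    · exact Or.inr (by simpa using hg)
    · exact Or.inl hg
  have hsymm : ∀ c, ReflTransGen r b c → c ∈ M \ D ∧ ReflTransGen r c b := by
    intro c hc
    induction hc with
    | refl => exact ⟨hbU, ReflTransGen.refl⟩
    | tail _ hyw ih =>
      obtain ⟨g, hg, hw, hwU⟩ := hyw
      exact ⟨hwU, ReflTransGen.head ⟨g⁻¹, hTinv g hg, by simp [hw], ih.1⟩ ih.2⟩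
  have hclosed : ∀ c, ReflTransGen r b c → ∀ g ∈ T, ReflTransGen r b (g • c) := by
    intro c hc g hg
    obtain ⟨hcU, hcb⟩ := hsymm c hc
    have hM := hDT c hcU g hg
    by_cases hD' : g • c ∈ D
    · refine absurd ?_ hbY
      simp only [Y, Set.mem_iUnion]
      exact ⟨c, ⟨g⁻¹, hTinv g hg, g • c, hD', by simp⟩, hcb, hcU⟩
    · exact hc.tail ⟨g, hg, rfl, hM, hD'⟩
  refine ⟨b, hbM, (hcompfin b hbU).subset ?_⟩
  rintro _ ⟨g, rfl⟩
  have hg : g ∈ Subgroup.closure S := by rw [hS]; trivial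
  suffices ∀ c, ReflTransGen r b c → ReflTransGen r b (g • c) from this b ReflTransGen.refl
  induction hg using Subgroup.closure_induction'' with
  | one => simp
  | mem x hx => exact fun c hc => hclosed c hc x (Or.inl hx)
  | inv_mem x hx => exact fun c hc => hclosed c hc x⁻¹ (Or.inr (by simpa using hx))
  | mul x y _ _ hx hy => exact fun c hc => by rw [mul_smul]; exact hx _ (hy c hc)

end Combinatorics

section LocalRing

open IsLocalRing

variable {k A : Type*} [Field k] [CommRing A] [IsLocalRing A] [Algebra k A]

theorem exists_form_sub_mem_pow {x y : A} (hxy : maximalIdeal A = Ideal.span {x, y})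
    (hk : ∀ a : A, ∃ c : k, a - algebraMap k A c ∈ maximalIdeal A) (n : ℕ) (z : A)
    (hz : z ∈ maximalIdeal A ^ n) :
    ∃ c : ℕ → k, z - ∑ i ∈ Finset.range (n + 1), algebraMap k A (c i) * (x ^ (n - i) * y ^ i) ∈
      maximalIdeal A ^ (n + 1) := by
  have hx : x ∈ maximalIdeal A := by rw [hxy]; exact Ideal.subset_span (by simp)
  have hy : y ∈ maximalIdeal A := by rw [hxy]; exact Ideal.subset_span (by simp)
  have key : ∀ (n : ℕ) (z : A), z ∈ maximalIdeal A ^ n →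
      ∃ a : ℕ → A, z = ∑ i ∈ Finset.range (n + 1), a i * (x ^ (n - i) * y ^ i) := by
    intro n
    induction n with
    | zero => exact fun z _ => ⟨fun _ => z, by simp⟩
    | succ n ih =>
      intro z hz
      have hz' : z ∈ (Ideal.span {x} ⊔ Ideal.span {y}) * maximalIdeal A ^ n := by
        rwa [← Ideal.span_insert, ← hxy, ← pow_succ']
      rw [Ideal.sup_mul, Submodule.mem_sup] at hz'
      obtain ⟨z1, hz1, z2, hz2, rfl⟩ := hz'
      obtain ⟨w1, hw1, rfl⟩ := Ideal.mem_span_singleton_mul.mp hz1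
      obtain ⟨w2, hw2, rfl⟩ := Ideal.mem_span_singleton_mul.mp hz2
      obtain ⟨a, rfl⟩ := ih w1 hw1
      obtain ⟨b, rfl⟩ := ih w2 hw2
      refine ⟨fun i => (if i ≤ n then a i else 0) + (if i = 0 then 0 else b (i - 1)), ?_⟩
      simp only [add_mul, Finset.sum_add_distrib]
      congr 1
      · rw [Finset.sum_range_succ _ (n + 1), if_neg (by omega), zero_mul, add_zero, Finset.mul_sum]
        refine Finset.sum_congr rfl fun i hi => ?_
        have hi' : i ≤ n := by simpa [Nat.lt_succ_iff] using hi
        rw [if_pos hi', Nat.succ_sub hi', pow_succ]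
        ring
      · rw [Finset.sum_range_succ' _ (n + 1), if_pos rfl, zero_mul, add_zero, Finset.mul_sum]
        refine Finset.sum_congr rfl fun i hi => ?_
        rw [if_neg (by omega), Nat.add_sub_cancel, Nat.add_sub_add_right, pow_succ]
        ring
  obtain ⟨a, rfl⟩ := key n z hz
  choose c hc using hk
  refine ⟨fun i => c (a i), ?_⟩
  rw [← Finset.sum_sub_distrib]
  refine Ideal.sum_mem _ fun i hi => ?_
  have hi' : i ≤ n := by simpa [Nat.lt_succ_iff] using hi
  rw [← sub_mul, pow_succ']
  refine Ideal.mul_mem_mul (hc _) ?_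
  have := Ideal.mul_mem_mul (Ideal.pow_mem_pow hx (n - i)) (Ideal.pow_mem_pow hy i)
  rwa [← pow_add, Nat.sub_add_cancel hi'] at this

theorem finite_quotient_of_le_radical [IsNoetherianRing A] {x y : A}
    (hxy : maximalIdeal A = Ideal.span {x, y})
    (hk : ∀ a : A, ∃ c : k, a - algebraMap k A c ∈ maximalIdeal A) (I : Ideal A)
    (hI : maximalIdeal A ≤ I.radical) : Module.Finite k (A ⧸ I) := by
  obtain ⟨n, hn⟩ := Ideal.exists_pow_le_of_le_radical_of_fg hI
    (IsNoetherian.noetherian (maximalIdeal A))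
  have key : ∀ n, ∃ W : Submodule k A, W.FG ∧ ∀ a, ∃ w ∈ W, a - w ∈ maximalIdeal A ^ n := by
    intro n
    induction n with
    | zero => exact ⟨⊥, Submodule.fg_bot, fun a => ⟨0, by simp, by simp⟩⟩
    | succ n ih =>
      obtain ⟨W, hW, h⟩ := ih
      refine ⟨W ⊔ Submodule.span k ((fun i => x ^ (n - i) * y ^ i) '' Set.Iio (n + 1)),
        hW.sup (Submodule.fg_span ((Set.finite_Iio _).image _)), fun a => ?_⟩
      obtain ⟨w, hw, haw⟩ := h a
      obtain ⟨c, hc⟩ := exists_form_sub_mem_pow hxy hk n _ haw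
      refine ⟨_, Submodule.add_mem_sup hw (Submodule.sum_mem _ fun i hi =>
        Submodule.smul_mem _ (c i) (Submodule.subset_span ⟨i, Finset.mem_range.mp hi, rfl⟩)),
        ?_⟩
      simpa only [Algebra.smul_def, ← sub_sub] using hc
  obtain ⟨W, hW, h⟩ := key n
  have : Module.Finite k W := Module.Finite.iff_fg.mpr hW
  refine Module.Finite.of_surjective ((Ideal.Quotient.mkₐ k I).toLinearMap ∘ₗ W.subtype) ?_
  intro b
  obtain ⟨a, rfl⟩ := Ideal.Quotient.mk_surjective b
  obtain ⟨w, hw, haw⟩ := h a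
  exact ⟨⟨w, hw⟩, ((Ideal.Quotient.mk_eq_mk_iff_sub_mem _ _).mpr (hn haw)).symm⟩

theorem sum_eq_pow_mul_isUnit {y : A} (hy : y ∈ maximalIdeal A) (n : ℕ) (c : ℕ → k)
    (hc : ∃ i ≤ n, c i ≠ 0) : ∃ s ≤ n, ∃ w : A, IsUnit w ∧
      ∑ i ∈ Finset.range (n + 1), algebraMap k A (c i) * y ^ i = y ^ s * w := by
  induction n generalizing c with
  | zero =>
    obtain ⟨i, hi, hci⟩ := hc
    obtain rfl : i = 0 := by omega
    exact ⟨0, le_rfl, algebraMap k A (c 0), (IsUnit.mk0 _ hci).map _, by simp⟩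
  | succ n ih =>
    by_cases h0 : c 0 = 0
    · obtain ⟨i, hi, hci⟩ := hc
      obtain ⟨j, rfl⟩ : ∃ j, i = j + 1 := ⟨i - 1, by
        have : i ≠ 0 := by rintro rfl; exact hci h0
        omega⟩
      obtain ⟨s, hs, w, hw, h⟩ := ih (fun i => c (i + 1)) ⟨j, by omega, hci⟩
      refine ⟨s + 1, by omega, w, hw, ?_⟩
      rw [Finset.sum_range_succ', h0, map_zero, zero_mul, add_zero, pow_succ', mul_assoc, ← h,
        Finset.mul_sum]
      exact Finset.sum_congr rfl fun i _ => by ring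
    · refine ⟨0, by omega, _, ?_, by rw [pow_zero, one_mul]⟩
      rw [Finset.sum_range_succ', pow_zero, mul_one]
      have hu : IsUnit (algebraMap k A (c 0)) := (IsUnit.mk0 _ h0).map _
      by_contra hcon
      have h1 : (∑ i ∈ Finset.range (n + 1), algebraMap k A (c (i + 1)) * y ^ (i + 1)) ∈
          maximalIdeal A := Ideal.sum_mem _ fun i _ => by
        rw [pow_succ']
        exact Ideal.mul_mem_left _ _ (Ideal.mul_mem_right _ _ hy)
      have h2 := (Ideal.add_mem_iff_right _ h1).mp ((mem_maximalIdeal _).mpr hcon)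
      exact (mem_maximalIdeal _).mp h2 hu

theorem blowup_finrank_lt [IsDomain A] [IsNoetherianRing A] {x y' y : A}
    (hxy' : maximalIdeal A = Ideal.span {x, y'}) (hxy : maximalIdeal A = Ideal.span {x, y})
    (hx0 : x ≠ 0) (hk : ∀ a : A, ∃ c : k, a - algebraMap k A c ∈ maximalIdeal A)
    (σ : A →ₐ[k] A) (hσx : σ x = x) (hσy : σ y' = x * y) (p q : A)
    (hp : p ∈ maximalIdeal A) (hq : q ∈ maximalIdeal A)
    (hI : maximalIdeal A ≤ (Ideal.span {p, q}).radical) :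
    ∃ (r : ℕ) (p' q' : A), σ p = x ^ r * p' ∧ σ q = x ^ r * q' ∧
      maximalIdeal A ≤ (Ideal.span {p', q'}).radical ∧
      Module.finrank k (A ⧸ Ideal.span {p', q'}) < Module.finrank k (A ⧸ Ideal.span {p, q}) := by
  classical
  set m := maximalIdeal A
  set I := Ideal.span {p, q} with hIdef
  have hx : x ∈ m := by rw [hxy]; exact Ideal.subset_span (by simp)
  have hy : y ∈ m := by rw [hxy]; exact Ideal.subset_span (by simp)
  have hy' : y' ∈ m := by rw [hxy']; exact Ideal.subset_span (by simp)
  have hpI : p ∈ I := Ideal.subset_span (by simp)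
  have hqI : q ∈ I := Ideal.subset_span (by simp)
  have hIm : I ≤ m := by
    rw [hIdef, Ideal.span_le]
    rintro z (rfl | rfl) <;> assumption
  have hex : ∃ n, ¬ I ≤ m ^ n := by
    by_contra! hcon
    have h1 : I ≤ ⊥ := by
      rw [← Ideal.iInf_pow_eq_bot_of_isLocalRing m (Ideal.IsPrime.ne_top inferInstance)]
      exact le_iInf hcon
    have h2 := hI hx
    rw [le_bot_iff.mp h1] at h2
    obtain ⟨j, hj⟩ := h2
    exact hx0 (eq_zero_of_pow_eq_zero hj)
  obtain ⟨r, hr1, hIr, hIr'⟩ : ∃ r, 1 ≤ r ∧ I ≤ m ^ r ∧ ¬ I ≤ m ^ (r + 1) := by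
    have h2 : Nat.find hex ≠ 0 := fun h => Nat.find_spec hex (by rw [h]; simp)
    have h3 : Nat.find hex ≠ 1 := fun h => Nat.find_spec hex (by rw [h]; simpa using hIm)
    refine ⟨Nat.find hex - 1, by omega, ?_, ?_⟩
    · simpa using Nat.find_min hex (m := Nat.find hex - 1) (by omega)
    · rw [Nat.sub_add_cancel (by omega)]
      exact Nat.find_spec hex
  have hσm : ∀ n, ∀ z ∈ m ^ n, ∃ d, σ z = x ^ n * d := by
    intro n z hz
    have h1 : m.map σ ≤ Ideal.span {x} := by
      rw [hxy', Ideal.map_span, Ideal.span_le]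
      rintro _ ⟨z, rfl | rfl, rfl⟩
      · simp [hσx]
      · rw [hσy]
        exact Ideal.mem_span_singleton.mpr (dvd_mul_right _ _)
    have h2 := Ideal.mem_map_of_mem σ hz
    rw [Ideal.map_pow] at h2
    have h3 := Ideal.pow_right_mono h1 n h2
    rw [Ideal.span_singleton_pow] at h3
    exact Ideal.mem_span_singleton.mp h3
  obtain ⟨p', hp'⟩ := hσm r p (hIr hpI)
  obtain ⟨q', hq'⟩ := hσm r q (hIr hqI)
  set I' := Ideal.span {p', q'} with hI'def
  have hxr : x ^ r ≠ 0 := pow_ne_zero _ hx0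
  have hp'I : p' ∈ I' := Ideal.subset_span (by simp)
  have hq'I : q' ∈ I' := Ideal.subset_span (by simp)
  have hII' : ∀ z ∈ I, ∀ d, σ z = x ^ r * d → d ∈ I' := by
    intro z hz d hd
    obtain ⟨a, b, rfl⟩ := Ideal.mem_span_pair.mp hz
    have : d = σ a * p' + σ b * q' := by
      apply mul_left_cancel₀ hxr
      rw [← hd, map_add, map_mul, map_mul, hp', hq']
      ring
    rw [this]
    exact Ideal.add_mem _ (Ideal.mul_mem_left _ _ hp'I) (Ideal.mul_mem_left _ _ hq'I)
  obtain ⟨L, hxL⟩ : ∃ L, x ^ L ∈ I' := by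
    obtain ⟨n, hn⟩ := hI hx
    refine ⟨n, hII' _ (I.mul_mem_left (x ^ r) hn) _ (by rw [map_mul, map_pow, map_pow, hσx])⟩
  have hyr : ∃ i ∈ I', ∃ b, y ^ r = i + x * b := by
    obtain ⟨z, hzI, hz⟩ := SetLike.not_le_iff_exists.mp hIr'
    obtain ⟨c, hc⟩ := exists_form_sub_mem_pow hxy' hk r z (hIr hzI)
    have hc0 : ∃ i ≤ r, c i ≠ 0 := by
      by_contra! hcon
      apply hz
      rwa [Finset.sum_eq_zero, sub_zero] at hc
      intro i hi
      rw [hcon i (by simpa [Nat.lt_succ_iff] using hi), map_zero, zero_mul]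
    obtain ⟨s, hs, w, hw, hsum⟩ := sum_eq_pow_mul_isUnit hy r c hc0
    obtain ⟨d, hd⟩ := hσm _ _ hc
    have hmem := hII' z hzI (y ^ s * w + x * d) (by
      have : σ z = σ (z - ∑ i ∈ Finset.range (r + 1), algebraMap k A (c i) *
          (x ^ (r - i) * y' ^ i)) + σ (∑ i ∈ Finset.range (r + 1), algebraMap k A (c i) *
          (x ^ (r - i) * y' ^ i)) := by rw [← map_add]; simp
      rw [this, hd, ← hsum, map_sum, mul_add, Finset.mul_sum, add_comm]
      congr 1
      · refine Finset.sum_congr rfl fun i hi => ?_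
        have hi' : i ≤ r := by simpa [Nat.lt_succ_iff] using hi
        rw [map_mul, map_mul, map_pow, map_pow, hσx, hσy, AlgHom.commutes, mul_pow,
          ← Nat.sub_add_cancel hi', pow_add]
        simp only [Nat.add_sub_cancel]
        ring
      · ring)
    obtain ⟨w', hw'⟩ := hw.exists_right_inv
    refine ⟨y ^ (r - s) * w' * (y ^ s * w + x * d), I'.mul_mem_left _ hmem,
      - (y ^ (r - s) * w' * d), ?_⟩
    have : y ^ r = y ^ (r - s) * y ^ s := by rw [← pow_add, Nat.sub_add_cancel hs]
    linear_combination this - y ^ (r - s) * y ^ s * hw'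
  have hradI' : m ≤ I'.radical := by
    have hxrad : x ∈ I'.radical := ⟨L, hxL⟩
    rw [hxy, Ideal.span_le]
    rintro z (rfl | rfl)
    · exact hxrad
    · obtain ⟨i, hi, b, hb⟩ := hyr
      refine Ideal.mem_radical_of_pow_mem (m := r) ?_
      rw [hb]
      exact Ideal.add_mem _ (Ideal.le_radical hi) (Ideal.mul_mem_right _ _ hxrad)
  refine ⟨r, p', q', hp', hq', hradI', ?_⟩
  have hfin : Module.Finite k (A ⧸ I) := finite_quotient_of_le_radical hxy hk I hI
  choose! D hD using hσm r
  let Ψ : (m ^ r).restrictScalars k →ₗ[k] A ⧸ I' :=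
    { toFun := fun z => Ideal.Quotient.mk I' (D z)
      map_add' := by
        rintro ⟨z, hz⟩ ⟨w, hw⟩
        rw [← map_add]
        congr 1
        apply mul_left_cancel₀ hxr
        rw [mul_add]
        change x ^ r * D (z + w) = _
        rw [← hD z hz, ← hD w hw, ← hD _ (Ideal.add_mem _ hz hw), map_add]
      map_smul' := by
        rintro c ⟨z, hz⟩
        have : D (c • z) = c • D z := by
          apply mul_left_cancel₀ hxr
          rw [mul_smul_comm, ← hD z hz, ← hD _ (Submodule.smul_of_tower_mem _ c hz), map_smul]
        change Ideal.Quotient.mkₐ k I' (D (c • z)) = c • Ideal.Quotient.mkₐ k I' (D z)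
        rw [this, map_smul] }
  have hΨ : ∀ z (hz : z ∈ m ^ r), ∀ d, σ z = x ^ r * d →
      Ψ ⟨z, hz⟩ = Ideal.Quotient.mk I' d := by
    intro z hz d hd
    change Ideal.Quotient.mk I' (D z) = _
    congr 1
    apply mul_left_cancel₀ hxr
    rw [← hD z hz, hd]
  have hΨsurj : Function.Surjective Ψ := by
    let T : Submodule k A := (LinearMap.range Ψ).comap (Ideal.Quotient.mkₐ k I').toLinearMap
    have hTI : ∀ a ∈ I', a ∈ T := fun a ha => ⟨0, by
      rw [map_zero]
      exact (Ideal.Quotient.eq_zero_iff_mem.mpr ha).symm⟩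
    have hTy : ∀ i ≤ r, y ^ i ∈ T := by
      intro i hi
      have hmem : x ^ (r - i) * y' ^ i ∈ m ^ r := by
        have := Ideal.mul_mem_mul (Ideal.pow_mem_pow hx (r - i)) (Ideal.pow_mem_pow hy' i)
        rwa [← pow_add, Nat.sub_add_cancel hi] at this
      refine ⟨⟨_, hmem⟩, hΨ _ hmem _ ?_⟩
      rw [map_mul, map_pow, map_pow, hσx, hσy, mul_pow, ← mul_assoc, ← pow_add,
        Nat.sub_add_cancel hi]
    have hTx : ∀ a ∈ T, x * a ∈ T := by
      rintro a ⟨⟨z, hz⟩, hza⟩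
      have hz' : x * z ∈ m ^ r := Ideal.mul_mem_left _ _ hz
      refine ⟨⟨_, hz'⟩, ?_⟩
      rw [hΨ _ hz' (x * D z) (by rw [map_mul, hσx, hD z hz]; ring), map_mul]
      change _ * Ψ ⟨z, hz⟩ = _
      rw [hza]
      simp
    have h1 : ∀ j ≤ r, ∀ a, ∃ t ∈ T, ∃ b c, a = t + y ^ j * b + x * c := by
      intro j
      induction j with
      | zero => exact fun _ a => ⟨0, zero_mem _, a, 0, by simp⟩
      | succ j ih =>
        intro hj a
        obtain ⟨t, ht, b, c, rfl⟩ := ih (by omega) a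
        obtain ⟨e, he⟩ := hk b
        rw [hxy] at he
        obtain ⟨b1, b2, hb⟩ := Ideal.mem_span_pair.mp he
        refine ⟨t + e • y ^ j, add_mem ht (T.smul_mem _ (hTy j (by omega))), b2, c + y ^ j * b1, ?_⟩
        rw [Algebra.smul_def]
        linear_combination -y ^ j * hb
    have h2 : ∀ a, ∃ t ∈ T, ∃ c, a = t + x * c := by
      intro a
      obtain ⟨t, ht, b, c, rfl⟩ := h1 r le_rfl a
      obtain ⟨i, hi, d, hd⟩ := hyr
      refine ⟨t + i * b, add_mem ht (hTI _ (I'.mul_mem_right _ hi)), c + d * b, ?_⟩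
      linear_combination b * hd
    have h3 : ∀ (l : ℕ) a, ∃ t ∈ T, ∃ c, a = t + x ^ l * c := by
      intro l
      induction l with
      | zero => exact fun a => ⟨0, zero_mem _, a, by simp⟩
      | succ l ih =>
        intro a
        obtain ⟨t, ht, c, rfl⟩ := ih a
        obtain ⟨t', ht', c', rfl⟩ := h2 c
        have hxl : ∀ l : ℕ, x ^ l * t' ∈ T := by
          intro l
          induction l with
          | zero => simpa
          | succ l ih =>
            rw [pow_succ', mul_assoc]
            exact hTx _ ih
        exact ⟨t + x ^ l * t', add_mem ht (hxl l), c', by ring⟩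
    intro b
    obtain ⟨a, rfl⟩ := Ideal.Quotient.mk_surjective b
    obtain ⟨t, ht, c, rfl⟩ := h3 L a
    exact (add_mem ht (hTI _ (I'.mul_mem_right c hxL)) : t + x ^ L * c ∈ T)
  let π : (m ^ r).restrictScalars k →ₗ[k] A ⧸ I :=
    (Ideal.Quotient.mkₐ k I).toLinearMap ∘ₗ ((m ^ r).restrictScalars k).subtype
  have hker : ∀ z, π z = 0 → Ψ z = 0 := by
    rintro ⟨z, hz⟩ h
    have hzI : z ∈ I := Ideal.Quotient.eq_zero_iff_mem.mp h
    exact Ideal.Quotient.eq_zero_iff_mem.mpr (hII' z hzI _ (hD z hz))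
  obtain ⟨s, hs⟩ := π.rangeRestrict.exists_rightInverse_of_surjective π.range_rangeRestrict
  have hsurj : Function.Surjective (Ψ ∘ₗ s) := by
    intro b
    obtain ⟨z, rfl⟩ := hΨsurj b
    refine ⟨π.rangeRestrict z, ?_⟩
    have h1 : π.rangeRestrict (s (π.rangeRestrict z)) = π.rangeRestrict z :=
      LinearMap.congr_fun hs _
    have h2 := hker (s (π.rangeRestrict z) - z) (by
      rw [map_sub, sub_eq_zero]
      exact congrArg Subtype.val h1)
    rw [map_sub, sub_eq_zero] at h2
    exact h2
  have hlt : LinearMap.range π < ⊤ := by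
    refine lt_top_iff_ne_top.mpr fun h => ?_
    have h1 : (1 : A ⧸ I) ∈ LinearMap.range π := by rw [h]; trivial
    obtain ⟨⟨z, hz⟩, h⟩ := h1
    have h2 : z - 1 ∈ I := (Ideal.Quotient.mk_eq_mk_iff_sub_mem _ _).mp h
    have h3 : z ∈ m := Ideal.pow_le_self (by omega) hz
    have h4 : (1 : A) ∈ m := by
      have := sub_mem h3 (hIm h2)
      simpa using this
    exact (Ideal.ne_top_iff_one m).mp (Ideal.IsPrime.ne_top inferInstance) h4
  calc _ ≤ Module.finrank k (LinearMap.range π) := LinearMap.finrank_le_finrank_of_surjective hsurj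
    _ < _ := Submodule.finrank_lt hlt.ne

end LocalRing

section RationalFunctions

variable {k K : Type*} [Field k] [Field K] [Algebra (MvPolynomial (Fin 2) k) K]
  [IsFractionRing (MvPolynomial (Fin 2) k) K] [Algebra k K]
  [IsScalarTower k (MvPolynomial (Fin 2) k) K]

variable (k K) in
def ratX : K := algebraMap (MvPolynomial (Fin 2) k) K (MvPolynomial.X 0)

variable (k K) in
def ratY : K := algebraMap (MvPolynomial (Fin 2) k) K (MvPolynomial.X 1)

omit [IsFractionRing (MvPolynomial (Fin 2) k) K] in
theorem algebraMap_eq_aeval (f : MvPolynomial (Fin 2) k) :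
    algebraMap (MvPolynomial (Fin 2) k) K f = MvPolynomial.aeval ![ratX k K, ratY k K] f := by
  have : IsScalarTower.toAlgHom k (MvPolynomial (Fin 2) k) K =
      MvPolynomial.aeval ![ratX k K, ratY k K] := by
    ext i
    fin_cases i <;> simp [ratX, ratY]
  exact DFunLike.congr_fun this f

omit [IsFractionRing (MvPolynomial (Fin 2) k) K] in
theorem algHom_algebraMap {L : Type*} [CommRing L] [Algebra k L] (h : K →ₐ[k] L)
    (f : MvPolynomial (Fin 2) k) : h (algebraMap (MvPolynomial (Fin 2) k) K f) =
      MvPolynomial.aeval ![h (ratX k K), h (ratY k K)] f := by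
  have h2 : (fun i => h (![ratX k K, ratY k K] i)) = ![h (ratX k K), h (ratY k K)] := by
    ext i
    fin_cases i <;> rfl
  rw [algebraMap_eq_aeval, MvPolynomial.comp_aeval_apply, h2]

theorem adjoin_ratX_ratY : IntermediateField.adjoin k {ratX k K, ratY k K} = ⊤ := by
  rw [eq_top_iff]
  rintro z -
  have hP : ∀ f : MvPolynomial (Fin 2) k, algebraMap (MvPolynomial (Fin 2) k) K f ∈
      IntermediateField.adjoin k {ratX k K, ratY k K} := by
    intro f
    rw [algebraMap_eq_aeval]
    have h0 : ratX k K ∈ IntermediateField.adjoin k {ratX k K, ratY k K} :=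
      IntermediateField.subset_adjoin _ _ (by simp)
    have h1 : ratY k K ∈ IntermediateField.adjoin k {ratX k K, ratY k K} :=
      IntermediateField.subset_adjoin _ _ (by simp)
    have := MvPolynomial.comp_aeval_apply (R := k) ![⟨ratX k K, h0⟩, ⟨ratY k K, h1⟩]
      (IntermediateField.adjoin k {ratX k K, ratY k K}).val f
    have h2 : (fun i => (IntermediateField.adjoin k {ratX k K, ratY k K}).val
        ((![⟨ratX k K, h0⟩, ⟨ratY k K, h1⟩] :
          Fin 2 → IntermediateField.adjoin k {ratX k K, ratY k K}) i)) =
        ![ratX k K, ratY k K] := by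
      ext i
      fin_cases i <;> rfl
    rw [h2] at this
    rw [← this]
    exact Subtype.prop _
  obtain ⟨f, g, -, rfl⟩ := IsFractionRing.div_surjective (MvPolynomial (Fin 2) k) z
  exact div_mem (hP f) (hP g)

theorem algebraicIndependent_of_mem_adjoin {u v : K}
    (hX : ratX k K ∈ IntermediateField.adjoin k {u, v})
    (hY : ratY k K ∈ IntermediateField.adjoin k {u, v}) : AlgebraicIndependent k ![u, v] := by
  have htop : IntermediateField.adjoin k {u, v} = ⊤ := by
    rw [eq_top_iff, ← adjoin_ratX_ratY (k := k) (K := K), IntermediateField.adjoin_le_iff]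
    rintro z (rfl | rfl) <;> assumption
  have hr : Set.range ![u, v] = {u, v} := by
    simp [Set.pair_comm]
  have halg : Algebra.IsAlgebraic (Algebra.adjoin k (Set.range ![u, v])) K := by
    rw [hr]
    refine ⟨fun z => ?_⟩
    have hz : z ∈ IntermediateField.adjoin k {u, v} := by rw [htop]; trivial
    obtain ⟨a, ha, b, hb, rfl⟩ := (IntermediateField.mem_adjoin_iff_div ..).mp hz
    rw [div_eq_mul_inv]
    exact (isAlgebraic_algebraMap (⟨a, ha⟩ : Algebra.adjoin k {u, v})).mul
      (isAlgebraic_algebraMap (⟨b, hb⟩ : Algebra.adjoin k {u, v})).inv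
  have htr : (Algebra.trdeg k K) = 2 := by
    have : Algebra.IsAlgebraic (MvPolynomial (Fin 2) k) K :=
      IsLocalization.isAlgebraic _ (nonZeroDivisors (MvPolynomial (Fin 2) k))
    have := (IsTranscendenceBasis.mvPolynomial (Fin 2) k).algebraMap_comp (A := K)
    have h2 := this.lift_cardinalMk_eq_trdeg
    simpa using h2.symm
  refine (Algebra.IsAlgebraic.isTranscendenceBasis_of_lift_le_trdeg_of_finite k ![u, v] ?_).1
  rw [htr]
  simp

theorem exists_algEquiv_of_mem_adjoin {u v : K}
    (hX : ratX k K ∈ IntermediateField.adjoin k {u, v})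
    (hY : ratY k K ∈ IntermediateField.adjoin k {u, v}) :
    ∃ g : K ≃ₐ[k] K, g (ratX k K) = u ∧ g (ratY k K) = v := by
  have hinj := algebraicIndependent_of_mem_adjoin hX hY
  let φ : K →ₐ[k] K := IsFractionRing.liftAlgHom (A := MvPolynomial (Fin 2) k) hinj
  have hφX : φ (ratX k K) = u := by
    have := IsFractionRing.lift_algebraMap (K := K) hinj (MvPolynomial.X 0)
    exact this.trans (by simp)
  have hφY : φ (ratY k K) = v := by
    have := IsFractionRing.lift_algebraMap (K := K) hinj (MvPolynomial.X 1)
    exact this.trans (by simp)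
  have hsurj : Function.Surjective φ := by
    rw [← AlgHom.fieldRange_eq_top, eq_top_iff, ← adjoin_ratX_ratY (k := k) (K := K),
      IntermediateField.adjoin_le_iff]
    have : IntermediateField.adjoin k {u, v} ≤ φ.fieldRange := by
      rw [IntermediateField.adjoin_le_iff]
      rintro z (rfl | rfl)
      exacts [⟨_, hφX⟩, ⟨_, hφY⟩]
    rintro z (rfl | rfl)
    exacts [this hX, this hY]
  exact ⟨AlgEquiv.ofBijective φ ⟨φ.injective, hsurj⟩, hφX, hφY⟩

end RationalFunctions

section OriginRing

set_option linter.unusedSectionVars false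

open IsLocalRing MvPolynomial

variable {k K : Type*} [Field k] [Field K] [Algebra (MvPolynomial (Fin 2) k) K]
  [IsFractionRing (MvPolynomial (Fin 2) k) K] [Algebra k K]
  [IsScalarTower k (MvPolynomial (Fin 2) k) K]

variable (k) in
abbrev originIdeal : Ideal (MvPolynomial (Fin 2) k) :=
  RingHom.ker (constantCoeff (R := k) (σ := Fin 2))

instance : (originIdeal k).IsPrime := RingHom.ker_isPrime _

variable (k K) in
def originRing : Subalgebra (MvPolynomial (Fin 2) k) K :=
  Localization.subalgebra.ofField K (originIdeal k).primeCompl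
    (originIdeal k).primeCompl_le_nonZeroDivisors

instance : IsLocalization.AtPrime (originRing k K) (originIdeal k) :=
  Localization.subalgebra.isLocalization_ofField K _ _

instance : IsLocalRing (originRing k K) :=
  IsLocalization.AtPrime.isLocalRing _ (originIdeal k)

instance : IsNoetherianRing (originRing k K) :=
  IsLocalization.isNoetherianRing (originIdeal k).primeCompl _ inferInstance

instance : UniqueFactorizationMonoid (originRing k K) :=
  UniqueFactorizationMonoid.of_isLocalization (originIdeal k).primeCompl _

instance : IsScalarTower k (originRing k K) K :=
  IsScalarTower.of_algebraMap_eq fun _ => rfl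

theorem mem_originRing_iff {z : K} : z ∈ originRing k K ↔
    ∃ f g : MvPolynomial (Fin 2) k, constantCoeff g ≠ 0 ∧
      z = algebraMap _ K f / algebraMap _ K g := by
  constructor
  · rintro ⟨f, g, hg, rfl⟩
    exact ⟨f, g, hg, (div_eq_mul_inv _ _).symm⟩
  · rintro ⟨f, g, hg, rfl⟩
    exact ⟨f, g, hg, div_eq_mul_inv _ _⟩

variable (k K) in
def originSet : Set K := {z | ∃ f g : MvPolynomial (Fin 2) k, constantCoeff f = 0 ∧
  constantCoeff g ≠ 0 ∧ z = algebraMap _ K f / algebraMap _ K g}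

variable (k K) in
def originResidue : originRing k K →+* k :=
  IsLocalization.lift (M := (originIdeal k).primeCompl) (g := constantCoeff)
    fun y => (IsUnit.mk0 _ y.2)

theorem originResidue_algebraMap (f : MvPolynomial (Fin 2) k) :
    originResidue k K (algebraMap _ _ f) = constantCoeff f :=
  IsLocalization.lift_eq _ _

theorem mem_maximalIdeal_iff_residue {z : originRing k K} :
    z ∈ maximalIdeal (originRing k K) ↔ originResidue k K z = 0 := by
  have h1 : (RingHom.ker (originResidue k K)).IsMaximal :=
    RingHom.ker_isMaximal_of_surjective _ fun c =>
      ⟨algebraMap _ _ (C c), by rw [originResidue_algebraMap, constantCoeff_C]⟩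
  rw [← RingHom.mem_ker, IsLocalRing.eq_maximalIdeal h1]

theorem coe_mem_originSet_iff {z : originRing k K} :
    (z : K) ∈ originSet k K ↔ z ∈ maximalIdeal (originRing k K) := by
  rw [mem_maximalIdeal_iff_residue]
  have key : ∀ f g : MvPolynomial (Fin 2) k, constantCoeff g ≠ 0 →
      (z : K) = algebraMap _ K f / algebraMap _ K g →
      (originResidue k K z = 0 ↔ constantCoeff f = 0) := by
    intro f g hg hz
    have hg0 : algebraMap _ K g ≠ 0 := by
      rw [Ne, FaithfulSMul.algebraMap_eq_zero_iff]
      rintro rfl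
      simp at hg
    have : z * algebraMap _ (originRing k K) g = algebraMap _ _ f := by
      apply Subtype.ext
      change (z : K) * algebraMap _ K g = algebraMap _ K f
      rw [hz, div_mul_cancel₀ _ hg0]
    rw [← originResidue_algebraMap (K := K), ← this, map_mul, originResidue_algebraMap]
    simp [hg]
  constructor
  · rintro ⟨f, g, hf, hg, hz⟩
    exact (key f g hg hz).mpr hf
  · intro h
    obtain ⟨f, g, hg, hz⟩ := mem_originRing_iff.mp z.2
    exact ⟨f, g, (key f g hg hz).mp h, hg, hz⟩

theorem mem_originRing_of_mem_originSet {z : K} (hz : z ∈ originSet k K) :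
    z ∈ originRing k K := by
  obtain ⟨f, g, -, hg, rfl⟩ := hz
  exact mem_originRing_iff.mpr ⟨f, g, hg, rfl⟩

theorem ratX_mem : ratX k K ∈ originSet k K := ⟨X 0, 1, by simp, by simp, by simp [ratX]⟩

theorem ratY_mem : ratY k K ∈ originSet k K := ⟨X 1, 1, by simp, by simp, by simp [ratY]⟩

theorem algebraMap_mem_originRing (c : k) : algebraMap k K c ∈ originRing k K :=
  (algebraMap k (originRing k K) c).2

theorem exists_sub_algebraMap_mem_maximalIdeal (z : originRing k K) :
    ∃ c : k, z - algebraMap k _ c ∈ maximalIdeal (originRing k K) := by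
  refine ⟨originResidue k K z, ?_⟩
  rw [mem_maximalIdeal_iff_residue, map_sub,
    IsScalarTower.algebraMap_apply k (MvPolynomial (Fin 2) k) (originRing k K),
    originResidue_algebraMap]
  simp

theorem exists_sub_mem_originSet {z : K} (hz : z ∈ originRing k K) :
    ∃ c : k, z - algebraMap k K c ∈ originSet k K := by
  obtain ⟨c, hc⟩ := exists_sub_algebraMap_mem_maximalIdeal ⟨z, hz⟩
  exact ⟨c, coe_mem_originSet_iff.mpr hc⟩

theorem add_mem_originSet {z w : K} (hz : z ∈ originSet k K) (hw : w ∈ originSet k K) :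
    z + w ∈ originSet k K := by
  have hz' := mem_originRing_of_mem_originSet hz
  have hw' := mem_originRing_of_mem_originSet hw
  exact coe_mem_originSet_iff.mpr (add_mem (coe_mem_originSet_iff (z := ⟨z, hz'⟩).mp hz)
    (coe_mem_originSet_iff (z := ⟨w, hw'⟩).mp hw))

theorem mul_mem_originSet {z w : K} (hz : z ∈ originRing k K) (hw : w ∈ originSet k K) :
    z * w ∈ originSet k K := by
  have hw' := mem_originRing_of_mem_originSet hw
  exact coe_mem_originSet_iff.mpr (Ideal.mul_mem_left _ ⟨z, hz⟩
    (coe_mem_originSet_iff (z := ⟨w, hw'⟩).mp hw))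

theorem sub_mem_originSet {z w : K} (hz : z ∈ originSet k K) (hw : w ∈ originSet k K) :
    z - w ∈ originSet k K := by
  have := add_mem_originSet hz (mul_mem_originSet (neg_mem (one_mem _)) hw)
  simpa [sub_eq_add_neg] using this

theorem algebraMap_mem_originSet {c : k} (h : algebraMap k K c ∈ originSet k K) : c = 0 := by
  have h1 := coe_mem_originSet_iff (z := algebraMap k (originRing k K) c).mp h
  rw [mem_maximalIdeal_iff_residue, 
    IsScalarTower.algebraMap_apply k (MvPolynomial (Fin 2) k) (originRing k K),
    originResidue_algebraMap] at h1
  simpa using h1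

theorem one_notMem_originSet : (1 : K) ∉ originSet k K := fun h =>
  one_ne_zero (algebraMap_mem_originSet (k := k) (K := K) (c := 1) (by simpa using h))

theorem mem_originSet_or_inv_mem {z : K} (hz : z ∈ originRing k K) :
    z ∈ originSet k K ∨ z⁻¹ ∈ originRing k K := by
  by_cases h : z ∈ originSet k K
  · exact Or.inl h
  · have hu : IsUnit (⟨z, hz⟩ : originRing k K) := by
      by_contra hcon
      exact h (coe_mem_originSet_iff.mpr ((mem_maximalIdeal _).mpr hcon))
    obtain ⟨w, hw⟩ := hu.exists_right_inv
    have : z * (w : K) = 1 := congrArg Subtype.val hw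
    rw [← eq_inv_of_mul_eq_one_right this]
    exact Or.inr w.2

theorem aeval_sub_mem {u v : K} (hu : u ∈ originSet k K) (hv : v ∈ originSet k K)
    (f : MvPolynomial (Fin 2) k) :
    aeval ![u, v] f - algebraMap k K (constantCoeff f) ∈ originSet k K := by
  let w : Fin 2 → originRing k K := ![⟨u, mem_originRing_of_mem_originSet hu⟩,
    ⟨v, mem_originRing_of_mem_originSet hv⟩]
  have hw : ∀ i, w i ∈ maximalIdeal (originRing k K) := fun i => by
    rw [← coe_mem_originSet_iff]
    fin_cases i
    exacts [hu, hv]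
  have h1 : aeval w f - algebraMap k _ (constantCoeff f) ∈ maximalIdeal (originRing k K) := by
    induction f using MvPolynomial.induction_on with
    | C a => simp
    | add p q hp hq =>
      have := add_mem hp hq
      simp only [map_add]
      convert! this using 1
      ring
    | mul_X p i hp =>
      simp only [map_mul, aeval_X, constantCoeff_X, mul_zero, map_zero, sub_zero]
      exact Ideal.mul_mem_left _ _ (hw i)
  have h2 := coe_mem_originSet_iff.mpr h1
  have h3 : ((aeval w f : originRing k K) : K) = aeval ![u, v] f := by
    have := MvPolynomial.comp_aeval_apply (R := k) w ((originRing k K).val.restrictScalars k) f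
    refine this.trans ?_
    congr 2
    ext i
    fin_cases i <;> rfl
  rw [← h3]
  exact h2

theorem algHom_mem_originSet (h : K →ₐ[k] K) (hX : h (ratX k K) ∈ originSet k K)
    (hY : h (ratY k K) ∈ originSet k K) {z : K} (hz : z ∈ originSet k K) :
    h z ∈ originSet k K := by
  obtain ⟨f, g, hf, hg, rfl⟩ := hz
  rw [map_div₀, algHom_algebraMap, algHom_algebraMap]
  have h1 := aeval_sub_mem hX hY f
  rw [hf, map_zero, sub_zero] at h1
  have h2 := aeval_sub_mem hX hY g
  have h3 : aeval ![h (ratX k K), h (ratY k K)] g ∈ originRing k K := by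
    have := add_mem (mem_originRing_of_mem_originSet h2)
      (algebraMap_mem_originRing (K := K) (constantCoeff g))
    simpa using this
  rw [div_eq_inv_mul]
  refine mul_mem_originSet ?_ h1
  refine (mem_originSet_or_inv_mem h3).resolve_left fun h4 => hg ?_
  have := sub_mem_originSet h4 h2
  rw [sub_sub_cancel] at this
  exact algebraMap_mem_originSet this

theorem mem_originRing_iff_exists_sub_mem {z : K} :
    z ∈ originRing k K ↔ ∃ c : k, z - algebraMap k K c ∈ originSet k K := by
  refine ⟨exists_sub_mem_originSet, fun ⟨c, hc⟩ => ?_⟩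
  have := add_mem (mem_originRing_of_mem_originSet hc) (algebraMap_mem_originRing (K := K) c)
  simpa using this

theorem originIdeal_eq : originIdeal k = Ideal.span {X 0, X 1} := by
  apply le_antisymm
  · intro f hf
    have key : ∀ f : MvPolynomial (Fin 2) k,
        f - C (constantCoeff f) ∈ Ideal.span {(X 0 : MvPolynomial (Fin 2) k), X 1} := by
      intro f
      induction f using MvPolynomial.induction_on with
      | C a => simp
      | add p q hp hq =>
        have := add_mem hp hq
        simp only [map_add]
        convert! this using 1
        ring
      | mul_X p i hp =>
        simp only [map_mul, constantCoeff_X, mul_zero, map_zero, sub_zero]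
        exact Ideal.mul_mem_left _ _ (Ideal.subset_span (by fin_cases i <;> simp))
    have := key f
    rwa [(RingHom.mem_ker).mp hf, map_zero, sub_zero] at this
  · rw [Ideal.span_le]
    rintro _ (rfl | rfl) <;> simp [RingHom.mem_ker]

theorem maximalIdeal_originRing_eq :
    maximalIdeal (originRing k K) =
      Ideal.span {algebraMap (MvPolynomial (Fin 2) k) _ (X 0),
        algebraMap (MvPolynomial (Fin 2) k) _ (X 1)} := by
  rw [← IsLocalization.AtPrime.map_eq_maximalIdeal (originIdeal k), originIdeal_eq,
    Ideal.map_span, Set.image_pair]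

theorem height_maximalIdeal_originRing_le : (maximalIdeal (originRing k K)).height ≤ 2 := by
  refine (Ideal.height_le_spanFinrank _ Ideal.IsPrime.ne_top').trans ?_
  rw [maximalIdeal_originRing_eq]
  exact_mod_cast (Submodule.spanFinrank_span_le_ncard_of_finite (Set.toFinite _)).trans
    ((Set.ncard_insert_le _ _).trans (by rw [Set.ncard_singleton]))

theorem maximalIdeal_le_radical_of_isRelPrime {p q : originRing k K} (h : IsRelPrime p q) :
    maximalIdeal (originRing k K) ≤ (Ideal.span {p, q}).radical := by
  rw [Ideal.radical_eq_sInf]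
  refine le_sInf ?_
  rintro Q ⟨hQ, hQp⟩
  have hpQ : p ∈ Q := hQ (Ideal.subset_span (by simp))
  have hqQ : q ∈ Q := hQ (Ideal.subset_span (by simp))
  have hp0 : p ≠ 0 := by
    rintro rfl
    exact hQp.ne_top (Q.eq_top_of_isUnit_mem hqQ (isRelPrime_zero_left.mp h))
  obtain ⟨π, hπ, hπp, hπQ⟩ : ∃ π, Prime π ∧ π ∣ p ∧ π ∈ Q := by
    obtain ⟨s, hs, u, hu⟩ := UniqueFactorizationMonoid.exists_prime_factors p hp0
    have h1 : s.prod ∈ Q := by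
      rw [← hu] at hpQ
      exact (hQp.mem_or_mem hpQ).resolve_right fun h =>
        hQp.ne_top (Q.eq_top_of_isUnit_mem h u.isUnit)
    obtain ⟨π, hπs, hπQ⟩ := (hQp.multiset_prod_mem_iff_exists_mem s).mp h1
    exact ⟨π, hs π hπs, (Multiset.dvd_prod hπs).trans ⟨u, hu.symm⟩, hπQ⟩
  have hπq : ¬ π ∣ q := fun hcon => hπ.not_isUnit (h hπp hcon)
  have h1 : (Ideal.span {π}).IsPrime := (Ideal.span_singleton_prime hπ.ne_zero).mpr hπ
  have h2 : (⊥ : Ideal (originRing k K)) < Ideal.span {π} := bot_lt_iff_ne_bot.mpr fun h =>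
    hπ.ne_zero (Ideal.span_singleton_eq_bot.mp h)
  have h3 : Ideal.span {π} < Q := by
    refine lt_of_le_of_ne ((Ideal.span_singleton_le_iff_mem _).mpr hπQ) fun h => hπq ?_
    rw [← Ideal.mem_span_singleton, h]
    exact hqQ
  by_contra hcon
  have h4 : Q < maximalIdeal (originRing k K) :=
    lt_of_le_of_ne (le_maximalIdeal hQp.ne_top) fun h => hcon h.ge
  have h5 := Ideal.height_add_one_le_of_lt_of_isPrime h2
  have h6 := Ideal.height_add_one_le_of_lt_of_isPrime h3
  have h7 := (Ideal.height_add_one_le_of_lt_of_isPrime h4).trans height_maximalIdeal_originRing_le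
  have h8 : (3 : ℕ∞) ≤ 2 := by
    calc (3 : ℕ∞) = 0 + 1 + 1 + 1 := by norm_num
      _ ≤ (⊥ : Ideal (originRing k K)).height + 1 + 1 + 1 := by gcongr; exact zero_le
      _ ≤ (Ideal.span {π}).height + 1 + 1 := by gcongr
      _ ≤ Q.height + 1 := by gcongr
      _ ≤ 2 := h7
  exact absurd h8 (by decide)

end OriginRing

section Domination

set_option linter.unusedSectionVars false

open IsLocalRing MvPolynomial

variable {k K : Type*} [Field k] [Field K] [Algebra (MvPolynomial (Fin 2) k) K]
  [IsFractionRing (MvPolynomial (Fin 2) k) K] [Algebra k K]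
  [IsScalarTower k (MvPolynomial (Fin 2) k) K]

theorem ratX_ne_zero : ratX k K ≠ 0 := by
  rw [ratX, Ne, FaithfulSMul.algebraMap_eq_zero_iff]
  exact MvPolynomial.X_ne_zero _

theorem ratY_ne_zero : ratY k K ≠ 0 := by
  rw [ratY, Ne, FaithfulSMul.algebraMap_eq_zero_iff]
  exact MvPolynomial.X_ne_zero _

def coordAt (c : Option k) (z : K) : K := c.elim z⁻¹ (fun a => z - algebraMap k K a)

theorem map_coordAt (g : K ≃ₐ[k] K) (c : Option k) (z : K) :
    g (coordAt c z) = coordAt c (g z) := by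
  cases c <;> simp [coordAt]

theorem mem_of_coordAt_mem {F : IntermediateField k K} {c : Option k} {z : K}
    (h : coordAt c z ∈ F) : z ∈ F := by
  cases c with
  | none => simpa [coordAt] using F.inv_mem h
  | some a => simpa [coordAt] using F.add_mem h (F.algebraMap_mem a)

theorem eq_of_coordAt_mem {c c' : Option k} {z : K} (hz0 : z ≠ 0) (h : coordAt c z ∈ originSet k K)
    (h' : coordAt c' z ∈ originSet k K) : c = c' := by
  have hmix : ∀ a : k, z - algebraMap k K a ∈ originSet k K →
      z⁻¹ ∈ originSet k K → False := by
    intro a h h'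
    have hz : z ∈ originRing k K := mem_originRing_iff_exists_sub_mem.mpr ⟨a, h⟩
    have h1 := mul_mem_originSet hz h'
    rw [mul_inv_cancel₀ hz0] at h1
    exact one_notMem_originSet h1
  cases c with
  | none =>
    cases c' with
    | none => rfl
    | some b => exact (hmix b h' h).elim
  | some a =>
    cases c' with
    | none => exact (hmix a h h').elim
    | some b =>
      have h1 := sub_mem_originSet h' h
      have h2 : z - algebraMap k K b - (z - algebraMap k K a) = algebraMap k K (a - b) := by
        rw [map_sub]; ring
      simp only [coordAt, Option.elim_some] at h1
      rw [h2] at h1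
      rw [sub_eq_zero.mp (algebraMap_mem_originSet h1)]

theorem exists_coordAt_mem {z : K} (h : z ∈ originRing k K ∨ z⁻¹ ∈ originRing k K) :
    ∃ c : Option k, coordAt c z ∈ originSet k K := by
  by_cases hz : z ∈ originRing k K
  · obtain ⟨c, hc⟩ := exists_sub_mem_originSet hz
    exact ⟨some c, hc⟩
  · refine ⟨none, (mem_originSet_or_inv_mem (h.resolve_left hz)).resolve_right fun h1 => hz ?_⟩
    rwa [inv_inv] at h1

variable (K) in
theorem exists_childAut (c : Option k) : ∃ g : K ≃ₐ[k] K,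
    g (ratX k K) = (c.elim (ratX k K / ratY k K) fun _ => ratX k K) ∧
    g (ratY k K) = (c.elim (ratY k K) fun a => ratY k K / ratX k K - algebraMap k K a) := by
  have hX := ratX_ne_zero (k := k) (K := K)
  have hY := ratY_ne_zero (k := k) (K := K)
  cases c with
  | none =>
    simp only [Option.elim_none]
    have h1 : ratX k K / ratY k K ∈ IntermediateField.adjoin k {ratX k K / ratY k K, ratY k K} :=
      IntermediateField.subset_adjoin _ _ (by simp)
    have h2 : ratY k K ∈ IntermediateField.adjoin k {ratX k K / ratY k K, ratY k K} :=
      IntermediateField.subset_adjoin _ _ (by simp)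
    refine exists_algEquiv_of_mem_adjoin ?_ h2
    simpa [hY] using mul_mem h1 h2
  | some a =>
    simp only [Option.elim_some]
    set F := IntermediateField.adjoin k {ratX k K, ratY k K / ratX k K - algebraMap k K a} with hF
    have h1 : ratX k K ∈ F := IntermediateField.subset_adjoin _ _ (by simp)
    have h2 : ratY k K / ratX k K - algebraMap k K a ∈ F :=
      IntermediateField.subset_adjoin _ _ (by simp)
    refine exists_algEquiv_of_mem_adjoin h1 ?_
    simpa [hX] using mul_mem (add_mem h2 (F.algebraMap_mem a)) h1

variable (K) in
def childAut (c : Option k) : K ≃ₐ[k] K := (exists_childAut K c).choose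

theorem childAut_none_ratX : childAut K (none : Option k) (ratX k K) =
    ratX k K / ratY k K :=
  (exists_childAut K (none : Option k)).choose_spec.1

theorem childAut_none_ratY : childAut K (none : Option k) (ratY k K) = ratY k K :=
  (exists_childAut K (none : Option k)).choose_spec.2

theorem childAut_some_ratX (a : k) : childAut K (some a) (ratX k K) = ratX k K :=
  (exists_childAut K (some a)).choose_spec.1

theorem childAut_some_ratY (a : k) :
    childAut K (some a) (ratY k K) = ratY k K / ratX k K - algebraMap k K a :=
  (exists_childAut K (some a)).choose_spec.2

theorem childAut_none_symm_ratX :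
    (childAut K (none : Option k)).symm (ratX k K) = ratX k K * ratY k K := by
  rw [AlgEquiv.symm_apply_eq, map_mul, childAut_none_ratX, childAut_none_ratY,
    div_mul_cancel₀ _ ratY_ne_zero]

theorem childAut_none_symm_ratY : (childAut K (none : Option k)).symm (ratY k K) = ratY k K := by
  rw [AlgEquiv.symm_apply_eq, childAut_none_ratY]

theorem childAut_some_symm_ratX (a : k) :
    (childAut K (some a)).symm (ratX k K) = ratX k K := by
  rw [AlgEquiv.symm_apply_eq, childAut_some_ratX]

theorem childAut_some_symm_ratY (a : k) : (childAut K (some a)).symm (ratY k K) =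
    ratX k K * (ratY k K + algebraMap k K a) := by
  rw [AlgEquiv.symm_apply_eq, map_mul, map_add, AlgEquiv.commutes, childAut_some_ratX,
    childAut_some_ratY, sub_add_cancel, mul_div_cancel₀ _ ratX_ne_zero]

variable (K) in
theorem exists_rootAut (a b : Option k) : ∃ g : K ≃ₐ[k] K,
    g (ratX k K) = coordAt a (ratX k K) ∧ g (ratY k K) = coordAt b (ratY k K) := by
  apply exists_algEquiv_of_mem_adjoin
  · exact mem_of_coordAt_mem (c := a) (IntermediateField.subset_adjoin _ _ (by simp))
  · exact mem_of_coordAt_mem (c := b) (IntermediateField.subset_adjoin _ _ (by simp))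

variable (K) in
def rootAut (r : Option k × Option k) : K ≃ₐ[k] K := (exists_rootAut K r.1 r.2).choose

theorem rootAut_ratX (r : Option k × Option k) :
    rootAut K r (ratX k K) = coordAt r.1 (ratX k K) := (exists_rootAut K r.1 r.2).choose_spec.1

theorem rootAut_ratY (r : Option k × Option k) :
    rootAut K r (ratY k K) = coordAt r.2 (ratY k K) := (exists_rootAut K r.1 r.2).choose_spec.2

def Dominates (h : K ≃ₐ[k] K) : Prop := ∀ z ∈ originSet k K, h z ∈ originSet k K

theorem dominates_iff {h : K ≃ₐ[k] K} :
    Dominates h ↔ h (ratX k K) ∈ originSet k K ∧ h (ratY k K) ∈ originSet k K :=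
  ⟨fun H => ⟨H _ ratX_mem, H _ ratY_mem⟩,
    fun H _ hz => algHom_mem_originSet (h : K →ₐ[k] K) H.1 H.2 hz⟩

theorem Dominates.map_originRing {h : K ≃ₐ[k] K} (H : Dominates h) {z : K}
    (hz : z ∈ originRing k K) : h z ∈ originRing k K := by
  rw [mem_originRing_iff_exists_sub_mem] at hz ⊢
  obtain ⟨c, hc⟩ := hz
  exact ⟨c, by simpa using H _ hc⟩

theorem Dominates.mem_of_map_mem {h : K ≃ₐ[k] K} (H : Dominates h) {z : K}
    (hz : z ∈ originRing k K) (hz' : h z ∈ originSet k K) : z ∈ originSet k K := by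
  obtain ⟨c, hc⟩ := exists_sub_mem_originSet hz
  have h1 := sub_mem_originSet hz' (H _ hc)
  rw [map_sub, sub_sub_cancel, AlgEquiv.commutes] at h1
  simpa [algebraMap_mem_originSet h1] using hc

theorem dominates_childAut_symm (c : Option k) : Dominates (childAut K c).symm := by
  rw [dominates_iff]
  cases c with
  | none =>
    rw [childAut_none_symm_ratX, childAut_none_symm_ratY]
    exact ⟨mul_mem_originSet (mem_originRing_of_mem_originSet ratX_mem) ratY_mem, ratY_mem⟩
  | some a =>
    rw [childAut_some_symm_ratX, childAut_some_symm_ratY, mul_comm]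
    exact ⟨ratX_mem, mul_mem_originSet (add_mem (mem_originRing_of_mem_originSet ratY_mem)
      (algebraMap_mem_originRing a)) ratX_mem⟩

theorem eq_of_dominates_childAut {h : K ≃ₐ[k] K} {c c' : Option k}
    (H : Dominates (h * childAut K c)) (H' : Dominates (h * childAut K c')) : c = c' := by
  have key : ∀ c : Option k, Dominates (h * childAut K c) →
      coordAt c (h (ratY k K / ratX k K)) ∈ originSet k K := by
    intro c H
    rw [← map_coordAt]
    cases c with
    | none => simpa [coordAt, childAut_none_ratX] using H _ ratX_mem
    | some a => simpa [coordAt, childAut_some_ratY] using H _ ratY_mem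
  refine eq_of_coordAt_mem ?_ (key c H) (key c' H')
  simp [ratX_ne_zero, ratY_ne_zero]

theorem exists_dominates_childAut {h : K ≃ₐ[k] K} (H : Dominates h)
    (hq : h (ratY k K / ratX k K) ∈ originRing k K ∨
      (h (ratY k K / ratX k K))⁻¹ ∈ originRing k K) :
    ∃ c, Dominates (h * childAut K c) := by
  obtain ⟨c, hc⟩ := exists_coordAt_mem hq
  refine ⟨c, dominates_iff.mpr ?_⟩
  rw [← map_coordAt] at hc
  cases c with
  | none =>
    simp only [AlgEquiv.mul_apply, childAut_none_ratX, childAut_none_ratY]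
    exact ⟨by simpa [coordAt] using hc, H _ ratY_mem⟩
  | some a =>
    simp only [AlgEquiv.mul_apply, childAut_some_ratX, childAut_some_ratY]
    exact ⟨H _ ratX_mem, hc⟩

theorem eq_of_dominates_rootAut {h : K ≃ₐ[k] K} {r r' : Option k × Option k}
    (H : Dominates (h * rootAut K r)) (H' : Dominates (h * rootAut K r')) : r = r' := by
  have h1 := H _ ratX_mem
  have h2 := H _ ratY_mem
  have h1' := H' _ ratX_mem
  have h2' := H' _ ratY_mem
  simp only [AlgEquiv.mul_apply, rootAut_ratX, rootAut_ratY, map_coordAt] at h1 h2 h1' h2'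
  exact Prod.ext (eq_of_coordAt_mem (by simp [ratX_ne_zero]) h1 h1')
    (eq_of_coordAt_mem (by simp [ratY_ne_zero]) h2 h2')

theorem exists_dominates_rootAut {h : K ≃ₐ[k] K}
    (hX : h (ratX k K) ∈ originRing k K ∨ (h (ratX k K))⁻¹ ∈ originRing k K)
    (hY : h (ratY k K) ∈ originRing k K ∨ (h (ratY k K))⁻¹ ∈ originRing k K) :
    ∃ r, Dominates (h * rootAut K r) := by
  obtain ⟨a, ha⟩ := exists_coordAt_mem hX
  obtain ⟨b, hb⟩ := exists_coordAt_mem hY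
  refine ⟨(a, b), dominates_iff.mpr ?_⟩
  simp only [AlgEquiv.mul_apply, rootAut_ratX, rootAut_ratY, map_coordAt]
  exact ⟨ha, hb⟩

end Domination

section RelPrimeRoot

open Polynomial

theorem coeff_mem_maximalIdeal_of_aeval_div_eq_zero {A F : Type*} [CommRing A] [IsDomain A]
    [IsLocalRing A] [UniqueFactorizationMonoid A] [Field F] [Algebra A F] [IsFractionRing A F]
    {a b : A} (hab : IsRelPrime a b) (ha : a ∈ IsLocalRing.maximalIdeal A)
    (hb : b ∈ IsLocalRing.maximalIdeal A) (ha0 : a ≠ 0) {q : A[X]}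
    (hq : aeval (algebraMap A F b / algebraMap A F a) q = 0) :
    q.map (IsLocalRing.residue A) = 0 := by
  have hprim : (C a * X - C b).IsPrimitive := by
    intro r hr
    rw [C_dvd_iff_dvd_coeff] at hr
    have h1 := hr 1
    have h0 := hr 0
    simp only [coeff_sub, coeff_C_mul, coeff_X_one, mul_one, coeff_C_succ, sub_zero,
      coeff_X_zero, mul_zero, coeff_C_zero, zero_sub, dvd_neg] at h1 h0
    exact hab h1 h0
  have ha1 : algebraMap A F a ≠ 0 := by simpa using ha0
  have hdvd : (C a * X - C b).map (algebraMap A F) ∣ q.map (algebraMap A F) := by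
    have h1 : (C a * X - C b).map (algebraMap A F) =
        C (algebraMap A F a) * (X - C (algebraMap A F b / algebraMap A F a)) := by
      rw [mul_sub, ← C_mul, mul_div_cancel₀ _ ha1]
      simp
    rw [h1, IsUnit.mul_left_dvd (by simpa using ha0), dvd_iff_isRoot, IsRoot.def, eval_map_algebraMap]
    exact hq
  obtain ⟨r, rfl⟩ := hprim.dvd_of_fraction_map_dvd_fraction_map hdvd
  have ha2 := Ideal.Quotient.eq_zero_iff_mem.mpr ha
  have hb2 := Ideal.Quotient.eq_zero_iff_mem.mpr hb
  have ha3 : IsLocalRing.residue A a = 0 := ha2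
  have hb3 : IsLocalRing.residue A b = 0 := hb2
  simp [ha3, hb3]

end RelPrimeRoot

section Factorization

set_option linter.unusedSectionVars false

open IsLocalRing MvPolynomial

variable {k K : Type*} [Field k] [Field K] [Algebra (MvPolynomial (Fin 2) k) K]
  [IsFractionRing (MvPolynomial (Fin 2) k) K] [Algebra k K]
  [IsScalarTower k (MvPolynomial (Fin 2) k) K]

instance : IsFractionRing (originRing k K) K :=
  Localization.subalgebra.isFractionRing_ofField K _ _

theorem X_zero_dvd_of_aeval_eq_zero {R : Type*} [CommRing R] {f : MvPolynomial (Fin 2) R}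
    (hf : aeval ![0, (Polynomial.X : Polynomial R)] f = 0) : X 0 ∣ f := by
  rw [← Ideal.mem_span_singleton, ← Ideal.Quotient.eq_zero_iff_mem]
  have h1 : (Ideal.Quotient.mkₐ R (Ideal.span {(X 0 : MvPolynomial (Fin 2) R)})) =
      ((Ideal.Quotient.mkₐ R (Ideal.span {(X 0 : MvPolynomial (Fin 2) R)})).comp
        (Polynomial.aeval (X 1))).comp (aeval ![0, (Polynomial.X : Polynomial R)]) := by
    ext i
    fin_cases i
    · simp
    · simp
  have h2 := DFunLike.congr_fun h1 f
  simp only [AlgHom.comp_apply, hf, map_zero] at h2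
  exact h2

theorem exists_symm_eq_div {θ : K ≃ₐ[k] K} {u a b : originRing k K}
    (hX : θ (ratX k K) = u) (hY : θ (ratY k K) = (b : K) / a)
    (hu : u ∈ maximalIdeal (originRing k K)) (hab : IsRelPrime a b)
    (ha : a ∈ maximalIdeal (originRing k K)) (hb : b ∈ maximalIdeal (originRing k K))
    (ha0 : a ≠ 0) {z : originRing k K} (hz : z ∈ maximalIdeal (originRing k K)) :
    ∃ F G : MvPolynomial (Fin 2) k, ¬ X 0 ∣ G ∧
      θ.symm z = ratX k K * algebraMap _ K F / algebraMap _ K G := by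
  obtain ⟨n, ⟨e, he⟩, hne, hmk⟩ :=
    IsFractionRing.exists_reduced_fraction (A := MvPolynomial (Fin 2) k) (θ.symm (z : K))
  have he0 : algebraMap (MvPolynomial (Fin 2) k) K e ≠ 0 := by
    simpa using nonZeroDivisors.ne_zero he
  rw [IsFractionRing.mk'_eq_div] at hmk
  suffices hn : X 0 ∣ n by
    obtain ⟨F, rfl⟩ := hn
    refine ⟨F, e, fun h => ?_, ?_⟩
    · exact (X_prime (R := k) (i := (0 : Fin 2))).not_isUnit (hne (dvd_mul_right _ _) h)
    · rw [← hmk, map_mul]; rfl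
  let φ : MvPolynomial (Fin 2) k →ₐ[k] Polynomial (originRing k K) :=
    aeval ![Polynomial.C u, Polynomial.X]
  have hφ : ∀ f, Polynomial.aeval ((b : K) / a) (φ f) = θ (algebraMap _ K f) := by
    intro f
    have h1 := algHom_algebraMap (θ : K →ₐ[k] K) f
    have h2 : ((Polynomial.aeval ((b : K) / a) : Polynomial (originRing k K) →ₐ[originRing k K] K).restrictScalars k).comp φ =
        aeval ![(θ : K →ₐ[k] K) (ratX k K), (θ : K →ₐ[k] K) (ratY k K)] := by
      ext i
      fin_cases i
      · simp [φ, hX]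
      · simp [φ, hY]
    exact (DFunLike.congr_fun h2 f).trans h1.symm
  have hroot : Polynomial.aeval ((b : K) / a) (φ n - Polynomial.C z * φ e) = 0 := by
    rw [Polynomial.aeval_sub, Polynomial.aeval_mul, hφ, hφ, Polynomial.aeval_C]
    have h3 : θ (θ.symm (z : K)) = z := θ.apply_symm_apply _
    rw [← hmk, map_div₀, div_eq_iff (by simpa using he0)] at h3
    rw [h3]
    exact sub_self _
  have hres := coeff_mem_maximalIdeal_of_aeval_div_eq_zero (F := K) hab ha hb ha0 hroot
  have hz0 : residue (originRing k K) z = 0 := by rwa [residue_eq_zero_iff]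
  rw [Polynomial.map_sub, Polynomial.map_mul, Polynomial.map_C, hz0, map_zero, zero_mul,
    sub_zero] at hres
  have hres2 : (φ n).map (originResidue k K) = 0 := by
    ext i
    have h4 := congrArg (fun p => Polynomial.coeff p i) hres
    simp only [Polynomial.coeff_map, Polynomial.coeff_zero, residue_eq_zero_iff] at h4 ⊢
    exact mem_maximalIdeal_iff_residue.mp h4
  apply X_zero_dvd_of_aeval_eq_zero
  refine Eq.trans ?_ hres2
  have h5 : ((aeval ![0, (Polynomial.X : Polynomial k)] :
      MvPolynomial (Fin 2) k →ₐ[k] Polynomial k) : MvPolynomial (Fin 2) k →+* Polynomial k) =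
      (Polynomial.mapRingHom (originResidue k K)).comp
        (φ : MvPolynomial (Fin 2) k →+* Polynomial (originRing k K)) := by
    apply MvPolynomial.ringHom_ext
    · intro c
      have h6 : algebraMap k (Polynomial (originRing k K)) c =
          Polynomial.C (algebraMap (MvPolynomial (Fin 2) k) (originRing k K) (C c)) := by
        rw [Polynomial.algebraMap_apply, IsScalarTower.algebraMap_apply k (MvPolynomial (Fin 2) k)
          (originRing k K)]
        rfl
      simp [φ, h6, originResidue_algebraMap]
    · intro i
      fin_cases i
      · simp [φ, mem_maximalIdeal_iff_residue.mp hu]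
      · simp [φ]
  exact DFunLike.congr_fun h5 n

theorem not_isRelPrime_of_map_ratX_ratY {θ : K ≃ₐ[k] K} {d a b : originRing k K}
    (hX : θ (ratX k K) = (d : K) * a) (hY : θ (ratY k K) = (b : K) / a)
    (hd : d ∈ maximalIdeal (originRing k K))
    (ha : a ∈ maximalIdeal (originRing k K)) (hb : b ∈ maximalIdeal (originRing k K)) :
    ¬ IsRelPrime a b := by
  intro hab
  have ha0 : a ≠ 0 := by
    rintro rfl
    simp [ratX_ne_zero] at hX
  have hX' : θ (ratX k K) = ((d * a : originRing k K) : K) := hX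
  obtain ⟨F, G, hG, h1⟩ := exists_symm_eq_div hX' hY (Ideal.mul_mem_left _ _ ha) hab ha hb ha0 hd
  obtain ⟨F', G', hG', h2⟩ :=
    exists_symm_eq_div hX' hY (Ideal.mul_mem_left _ _ ha) hab ha hb ha0 ha
  have h3 : θ.symm d * θ.symm a = ratX k K := by
    rw [← map_mul, ← hX, AlgEquiv.symm_apply_apply]
  have hG0 : algebraMap (MvPolynomial (Fin 2) k) K G ≠ 0 := by
    rw [Ne, FaithfulSMul.algebraMap_eq_zero_iff]; rintro rfl; exact hG (dvd_zero _)
  have hG0' : algebraMap (MvPolynomial (Fin 2) k) K G' ≠ 0 := by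
    rw [Ne, FaithfulSMul.algebraMap_eq_zero_iff]; rintro rfl; exact hG' (dvd_zero _)
  rw [h1, h2] at h3
  have hX0 := ratX_ne_zero (k := k) (K := K)
  have h4 : algebraMap (MvPolynomial (Fin 2) k) K (G * G') =
      algebraMap (MvPolynomial (Fin 2) k) K (X 0 * (F * F')) := by
    simp only [map_mul]
    rw [← ratX]
    field_simp at h3
    linear_combination -h3
  have h5 := FaithfulSMul.algebraMap_injective _ K h4
  exact ((X_prime (R := k) (i := (0 : Fin 2))).dvd_or_dvd (Dvd.intro _ h5.symm)).elim hG hG'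

theorem Dominates.exists_prime_dvd {h : K ≃ₐ[k] K} (H : Dominates h) (hn : ¬ Dominates h⁻¹) :
    ∃ π : originRing k K, Prime π ∧ π ∣ ⟨h (ratX k K), mem_originRing_of_mem_originSet (H _ ratX_mem)⟩ ∧
      π ∣ ⟨h (ratY k K), mem_originRing_of_mem_originSet (H _ ratY_mem)⟩ := by
  have he : ∃ e ∈ originRing k K, h⁻¹ e ∉ originRing k K := by
    by_contra! hc
    refine hn (dominates_iff.mpr ⟨?_, ?_⟩)
    · refine H.mem_of_map_mem (hc _ (mem_originRing_of_mem_originSet ratX_mem)) ?_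
      exact (h.apply_symm_apply (ratX k K)).symm ▸ ratX_mem
    · refine H.mem_of_map_mem (hc _ (mem_originRing_of_mem_originSet ratY_mem)) ?_
      exact (h.apply_symm_apply (ratY k K)).symm ▸ ratY_mem
  obtain ⟨e, heO, he⟩ := he
  obtain ⟨f, ⟨g, hg⟩, hfg, hmk⟩ :=
    IsFractionRing.exists_reduced_fraction (A := originRing k K) (h⁻¹ e)
  rw [IsFractionRing.mk'_eq_div] at hmk
  have hg0 : g ≠ 0 := nonZeroDivisors.ne_zero hg
  have hgK : (g : K) ≠ 0 := by simpa using hg0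
  have hmk' : h (f : K) = h g * e := by
    have h1 : h (h⁻¹ e) = e := h.apply_symm_apply e
    have h2 : (f : K) / g = h⁻¹ e := hmk
    rw [← h2, map_div₀, div_eq_iff (by simpa using hgK)] at h1
    rw [h1, mul_comm]
  have hgm : (g : K) ∈ originSet k K := by
    refine (mem_originSet_or_inv_mem g.2).resolve_right fun h1 => he ?_
    rw [← hmk]
    change (f : K) / g ∈ _
    rw [div_eq_mul_inv]
    exact mul_mem f.2 h1
  let hg' : originRing k K := ⟨h g, mem_originRing_of_mem_originSet (H _ hgm)⟩
  have hg'm : hg' ∈ maximalIdeal (originRing k K) := coe_mem_originSet_iff.mp (H _ hgm)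
  have hg'0 : hg' ≠ 0 := by
    intro h1
    have : h (g : K) = 0 := congrArg Subtype.val h1
    exact hgK (by simpa using this)
  obtain ⟨π, hπ, hπg⟩ := WfDvdMonoid.exists_irreducible_factor hg'm hg'0
  have hrad := maximalIdeal_le_radical_of_isRelPrime hfg
  have key : ∀ z (hz : z ∈ originSet k K),
      π ∣ ⟨h z, mem_originRing_of_mem_originSet (H _ hz)⟩ := by
    intro z hz
    obtain ⟨N, hN⟩ := hrad (coe_mem_originSet_iff.mp
      (show ((⟨z, mem_originRing_of_mem_originSet hz⟩ : originRing k K) : K) ∈ _ from hz))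
    obtain ⟨r, s, hrs⟩ := Ideal.mem_span_pair.mp hN
    apply hπ.prime.dvd_of_dvd_pow (n := N)
    refine hπg.trans ⟨⟨h r, H.map_originRing r.2⟩ * ⟨e, heO⟩ + ⟨h s, H.map_originRing s.2⟩, ?_⟩
    apply Subtype.ext
    have h3 := congrArg (fun t : originRing k K => h (t : K)) hrs
    push_cast at h3
    simp only [map_add, map_mul, map_pow, hmk'] at h3
    push_cast
    change h z ^ N = h g * (h r * e + h s)
    rw [← h3]; ring
  exact ⟨π, hπ.prime, key _ ratX_mem, key _ ratY_mem⟩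

theorem Dominates.exists_dominates_mul_childAut {h : K ≃ₐ[k] K} (H : Dominates h)
    (hn : ¬ Dominates h⁻¹) : ∃ c, Dominates (h * childAut K c) := by
  obtain ⟨π, hπ, hπX, hπY⟩ := H.exists_prime_dvd hn
  have hu0 : (⟨h (ratX k K), mem_originRing_of_mem_originSet (H _ ratX_mem)⟩ :
      originRing k K) ≠ 0 := by
    intro h1
    have : h (ratX k K) = 0 := congrArg Subtype.val h1
    exact ratX_ne_zero (by simpa using this)
  obtain ⟨a, b, d, hab, hda, hdb⟩ := UniqueFactorizationMonoid.exists_reduced_factors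
    (⟨h (ratX k K), mem_originRing_of_mem_originSet (H _ ratX_mem)⟩ : originRing k K) hu0
    ⟨h (ratY k K), mem_originRing_of_mem_originSet (H _ ratY_mem)⟩
  have hπd : π ∣ d := by
    rw [← hda] at hπX
    rw [← hdb] at hπY
    by_contra hd
    exact hπ.not_isUnit (hab ((hπ.dvd_or_dvd hπX).resolve_left hd)
      ((hπ.dvd_or_dvd hπY).resolve_left hd))
  have hdm : d ∈ maximalIdeal (originRing k K) := fun hd => hπ.not_isUnit (isUnit_of_dvd_unit hπd hd)
  have hX : h (ratX k K) = (d : K) * a := (congrArg Subtype.val hda).symm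
  have hY : h (ratY k K) = (d : K) * b := (congrArg Subtype.val hdb).symm
  have hda0 : (d : K) * a ≠ 0 := by
    rw [← hX]; simpa using ratX_ne_zero (k := k) (K := K)
  have hd0 := left_ne_zero_of_mul hda0
  have ha0 := right_ne_zero_of_mul hda0
  have hq : h (ratY k K / ratX k K) = (b : K) / a := by
    rw [map_div₀, hX, hY, mul_div_mul_left _ _ hd0]
  have hinv : ∀ t : originRing k K, t ∉ maximalIdeal (originRing k K) →
      (t : K)⁻¹ ∈ originRing k K := fun t ht =>
    (mem_originSet_or_inv_mem t.2).resolve_left fun h1 => ht (coe_mem_originSet_iff.mp h1)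
  by_cases ha : a ∈ maximalIdeal (originRing k K)
  · by_cases hb : b ∈ maximalIdeal (originRing k K)
    · refine (not_isRelPrime_of_map_ratX_ratY (θ := h * childAut K (some (0 : k)))
        (d := d) (a := a) (b := b) ?_ ?_ hdm ha hb hab).elim
      · rw [AlgEquiv.mul_apply, childAut_some_ratX, hX]
      · rw [AlgEquiv.mul_apply, childAut_some_ratY, map_zero, sub_zero, hq]
    · refine exists_dominates_childAut H (Or.inr ?_)
      rw [hq, inv_div, div_eq_mul_inv]
      exact mul_mem a.2 (hinv b hb)
  · refine exists_dominates_childAut H (Or.inl ?_)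
    rw [hq, div_eq_mul_inv]
    exact mul_mem b.2 (hinv a ha)

end Factorization

section Determinacy

set_option linter.unusedSectionVars false

open IsLocalRing MvPolynomial

variable {k K : Type*} [Field k] [Field K] [Algebra (MvPolynomial (Fin 2) k) K]
  [IsFractionRing (MvPolynomial (Fin 2) k) K] [Algebra k K]
  [IsScalarTower k (MvPolynomial (Fin 2) k) K]

theorem Dominates.exists_restrict {h : K ≃ₐ[k] K} (H : Dominates h) :
    ∃ σ : originRing k K →ₐ[k] originRing k K, ∀ z, (σ z : K) = h z :=
  ⟨{ toFun := fun z => ⟨h z, H.map_originRing z.2⟩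
     map_one' := Subtype.ext (map_one h)
     map_zero' := Subtype.ext (map_zero h)
     map_add' := fun _ _ => Subtype.ext (map_add h _ _)
     map_mul' := fun _ _ => Subtype.ext (map_mul h _ _)
     commutes' := fun c => Subtype.ext (h.commutes c) }, fun _ => rfl⟩

/-- The rational function `f` has a well-defined value in `ℙ¹` at the origin. -/
def Determined (k : Type*) {K : Type*} [Field k] [Field K] [Algebra (MvPolynomial (Fin 2) k) K]
    [IsFractionRing (MvPolynomial (Fin 2) k) K] (f : K) : Prop :=
  f ∈ originRing k K ∨ f⁻¹ ∈ originRing k K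

theorem Dominates.determined {h : K ≃ₐ[k] K} (H : Dominates h) {f : K} (hf : Determined k f) :
    Determined k (h f) := by
  refine hf.imp H.map_originRing fun h1 => ?_
  rw [← map_inv₀]
  exact H.map_originRing h1

/-- The rational function `f` becomes determined after `n` point blowups. -/
def DeterminedAfter (k : Type*) {K : Type*} [Field k] [Field K]
    [Algebra (MvPolynomial (Fin 2) k) K] [IsFractionRing (MvPolynomial (Fin 2) k) K] [Algebra k K]
    [IsScalarTower k (MvPolynomial (Fin 2) k) K] : ℕ → K → Prop
  | 0, f => Determined k f
  | n + 1, f => ∀ c : Option k, DeterminedAfter k n ((childAut K c).symm f)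

theorem DeterminedAfter.succ {n : ℕ} {f : K} (h : DeterminedAfter k n f) :
    DeterminedAfter k (n + 1) f := by
  induction n generalizing f with
  | zero => exact fun c => (dominates_childAut_symm c).determined h
  | succ n ih => exact fun c => ih (h c)

theorem DeterminedAfter.mono {n m : ℕ} (hnm : n ≤ m) {f : K} (h : DeterminedAfter k n f) :
    DeterminedAfter k m f := by
  induction hnm with
  | refl => exact h
  | step _ ih => exact ih.succ

theorem determined_div {p q : originRing k K}
    (h : ¬ (p ∈ maximalIdeal (originRing k K) ∧ q ∈ maximalIdeal (originRing k K))) :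
    Determined k ((p : K) / q) := by
  have hinv : ∀ t : originRing k K, t ∉ maximalIdeal (originRing k K) →
      (t : K)⁻¹ ∈ originRing k K := fun t ht =>
    (mem_originSet_or_inv_mem t.2).resolve_left fun h1 => ht (coe_mem_originSet_iff.mp h1)
  by_cases hq : q ∈ maximalIdeal (originRing k K)
  · right
    rw [inv_div, div_eq_mul_inv]
    exact mul_mem q.2 (hinv p fun hp => h ⟨hp, hq⟩)
  · left
    rw [div_eq_mul_inv]
    exact mul_mem p.2 (hinv q hq)

theorem childAut_symm_finrank_lt (c : Option k) {σ : originRing k K →ₐ[k] originRing k K}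
    (hσ : ∀ z, (σ z : K) = (childAut K c).symm z) {p q : originRing k K}
    (hp : p ∈ maximalIdeal (originRing k K)) (hq : q ∈ maximalIdeal (originRing k K))
    (hI : maximalIdeal (originRing k K) ≤ (Ideal.span {p, q}).radical) :
    ∃ (x : originRing k K) (r : ℕ) (p' q' : originRing k K), x ≠ 0 ∧
      σ p = x ^ r * p' ∧ σ q = x ^ r * q' ∧
      maximalIdeal (originRing k K) ≤ (Ideal.span {p', q'}).radical ∧
      Module.finrank k (originRing k K ⧸ Ideal.span {p', q'}) <
        Module.finrank k (originRing k K ⧸ Ideal.span {p, q}) := by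
  set x : originRing k K := algebraMap (MvPolynomial (Fin 2) k) _ (X 0) with hx
  set y : originRing k K := algebraMap (MvPolynomial (Fin 2) k) _ (X 1) with hy
  have hxK : (x : K) = ratX k K := rfl
  have hyK : (y : K) = ratY k K := rfl
  have hx0 : x ≠ 0 := by
    intro h
    exact ratX_ne_zero (k := k) (K := K) (hxK ▸ congrArg Subtype.val h)
  have hy0 : y ≠ 0 := by
    intro h
    exact ratY_ne_zero (k := k) (K := K) (hyK ▸ congrArg Subtype.val h)
  have hm : maximalIdeal (originRing k K) = Ideal.span {x, y} := maximalIdeal_originRing_eq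
  cases c with
  | none =>
    have hm' : maximalIdeal (originRing k K) = Ideal.span {y, x} := by rw [hm, Ideal.span_pair_comm]
    obtain ⟨r, p', q', h⟩ := blowup_finrank_lt hm' hm' hy0 exists_sub_algebraMap_mem_maximalIdeal σ
      (Subtype.ext ((hσ y).trans childAut_none_symm_ratY))
      (Subtype.ext ((hσ x).trans (childAut_none_symm_ratX.trans (mul_comm _ _)))) p q hp hq hI
    exact ⟨y, r, p', q', hy0, h⟩
  | some a =>
    have hm' : maximalIdeal (originRing k K) =
        Ideal.span {x, y - algebraMap k (originRing k K) a * x} := by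
      rw [hm]
      apply le_antisymm <;> rw [Ideal.span_le] <;> rintro z (rfl | rfl)
      · exact Ideal.subset_span (by simp)
      · exact Ideal.mem_span_pair.mpr ⟨algebraMap k (originRing k K) a, 1, by ring⟩
      · exact Ideal.subset_span (by simp)
      · exact Ideal.mem_span_pair.mpr ⟨-algebraMap k (originRing k K) a, 1, by ring⟩
    have hσx : σ x = x := Subtype.ext ((hσ x).trans (childAut_some_symm_ratX a))
    have hσy : σ (y - algebraMap k (originRing k K) a * x) = x * y := by
      rw [map_sub, map_mul, AlgHom.commutes, hσx, sub_eq_iff_eq_add]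
      apply Subtype.ext
      rw [hσ y, hyK, childAut_some_symm_ratY]
      change _ = ratX k K * ratY k K + algebraMap k K a * ratX k K
      ring
    obtain ⟨r, p', q', h⟩ := blowup_finrank_lt hm' hm hx0 exists_sub_algebraMap_mem_maximalIdeal σ
      hσx hσy p q hp hq hI
    exact ⟨x, r, p', q', hx0, h⟩

theorem determinedAfter_of_finrank_lt (n : ℕ) {p q : originRing k K}
    (hp : p ∈ maximalIdeal (originRing k K)) (hq : q ∈ maximalIdeal (originRing k K))
    (hI : maximalIdeal (originRing k K) ≤ (Ideal.span {p, q}).radical)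
    (hn : Module.finrank k (originRing k K ⧸ Ideal.span {p, q}) < n) :
    DeterminedAfter k n ((p : K) / q) := by
  induction n generalizing p q with
  | zero => exact absurd hn (Nat.not_lt_zero _)
  | succ n ih =>
    intro c
    obtain ⟨σ, hσ⟩ := (dominates_childAut_symm (K := K) c).exists_restrict
    obtain ⟨x, r, p', q', hx, h1, h2, h3, h4⟩ := childAut_symm_finrank_lt c hσ hp hq hI
    have hxK : (x : K) ^ r ≠ 0 := pow_ne_zero _ (by simpa using hx)
    have h5 : (childAut K c).symm ((p : K) / q) = (p' : K) / q' := by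
      rw [map_div₀, ← hσ, ← hσ, h1, h2]
      push_cast
      rw [mul_div_mul_left _ _ hxK]
    rw [h5]
    by_cases hpq : p' ∈ maximalIdeal (originRing k K) ∧ q' ∈ maximalIdeal (originRing k K)
    · exact ih hpq.1 hpq.2 h3 (by omega)
    · exact DeterminedAfter.mono (Nat.zero_le n) (determined_div hpq)

theorem exists_determinedAfter (f : K) : ∃ n, DeterminedAfter k n f := by
  obtain ⟨p, ⟨q, hq⟩, hpq, rfl⟩ :=
    IsFractionRing.exists_reduced_fraction (A := originRing k K) f
  rw [IsFractionRing.mk'_eq_div]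
  by_cases h : p ∈ maximalIdeal (originRing k K) ∧ q ∈ maximalIdeal (originRing k K)
  · exact ⟨_, determinedAfter_of_finrank_lt _ h.1 h.2 (maximalIdeal_le_radical_of_isRelPrime hpq)
      (Nat.lt_succ_self _)⟩
  · exact ⟨0, determined_div h⟩

theorem Dominates.inv_of_determined {h : K ≃ₐ[k] K} (H : Dominates h)
    (hX : Determined k (h⁻¹ (ratX k K))) (hY : Determined k (h⁻¹ (ratY k K))) :
    Dominates h⁻¹ := by
  have key : ∀ z ∈ originSet k K, z ≠ 0 → Determined k (h⁻¹ z) → h⁻¹ z ∈ originSet k K := by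
    intro z hz hz0 hd
    have h1 : h (h⁻¹ z) = z := h.apply_symm_apply z
    rcases hd with hd | hd
    · exact H.mem_of_map_mem hd (h1.symm ▸ hz)
    · have h2 := H.map_originRing hd
      rw [map_inv₀, h1] at h2
      have h3 := mul_mem_originSet h2 hz
      rw [inv_mul_cancel₀ hz0] at h3
      exact (one_notMem_originSet h3).elim
  exact dominates_iff.mpr ⟨key _ ratX_mem ratX_ne_zero hX, key _ ratY_mem ratY_ne_zero hY⟩

theorem not_dominates_childAut (c : Option k) : ¬ Dominates (childAut K c) := by
  intro H
  have hX := ratX_ne_zero (k := k) (K := K)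
  have hY := ratY_ne_zero (k := k) (K := K)
  cases c with
  | none =>
    have h1 := H _ ratX_mem
    rw [childAut_none_ratX] at h1
    obtain ⟨τ, h2, h3⟩ := exists_algEquiv_of_mem_adjoin (k := k) (K := K)
      (u := ratX k K + ratY k K) (v := ratY k K)
      (by simpa using sub_mem (IntermediateField.subset_adjoin k {ratX k K + ratY k K, ratY k K}
            (Set.mem_insert _ _)) (IntermediateField.subset_adjoin k
              {ratX k K + ratY k K, ratY k K} (Set.mem_insert_of_mem _ rfl)))
      (IntermediateField.subset_adjoin _ _ (by simp))
    have h4 : Dominates τ := dominates_iff.mpr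
      ⟨by rw [h2]; exact add_mem_originSet ratX_mem ratY_mem, by rw [h3]; exact ratY_mem⟩
    have h5 := sub_mem_originSet (h4 _ h1) h1
    rw [map_div₀, h2, h3, add_div, div_self hY, add_sub_cancel_left] at h5
    exact one_notMem_originSet h5
  | some a =>
    have h1 := H _ ratY_mem
    rw [childAut_some_ratY] at h1
    obtain ⟨τ, h2, h3⟩ := exists_algEquiv_of_mem_adjoin (k := k) (K := K)
      (u := ratX k K) (v := ratY k K + ratX k K)
      (IntermediateField.subset_adjoin _ _ (by simp))
      (by simpa using sub_mem (IntermediateField.subset_adjoin k {ratX k K, ratY k K + ratX k K}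
            (Set.mem_insert_of_mem _ rfl)) (IntermediateField.subset_adjoin k
              {ratX k K, ratY k K + ratX k K} (Set.mem_insert _ _)))
    have h4 : Dominates τ := dominates_iff.mpr
      ⟨by rw [h2]; exact ratX_mem, by rw [h3]; exact add_mem_originSet ratY_mem ratX_mem⟩
    have h5 := sub_mem_originSet (h4 _ h1) h1
    rw [map_sub, map_div₀, h2, h3, add_div, div_self hX, AlgEquiv.commutes] at h5
    ring_nf at h5
    exact one_notMem_originSet h5

end Determinacy

section Points

set_option linter.unusedSectionVars false

open IsLocalRing MvPolynomial
open scoped Pointwise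

variable {k K : Type*} [Field k] [Field K] [Algebra (MvPolynomial (Fin 2) k) K]
  [IsFractionRing (MvPolynomial (Fin 2) k) K] [Algebra k K]
  [IsScalarTower k (MvPolynomial (Fin 2) k) K]

variable (k K) in
/-- The maximal ideals (as subsets of the function field) of all local rings obtained from the
local ring at the origin by a Cremona transformation. -/
abbrev OriginOrbit : Type _ := MulAction.orbit (K ≃ₐ[k] K) (originSet k K)

def orbitPoint (g : K ≃ₐ[k] K) : OriginOrbit k K := ⟨g • originSet k K, g, rfl⟩

theorem exists_eq_orbitPoint (b : OriginOrbit k K) : ∃ g, b = orbitPoint g := by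
  obtain ⟨_, g, rfl⟩ := b
  exact ⟨g, rfl⟩

theorem smul_orbitPoint (s g : K ≃ₐ[k] K) : s • orbitPoint g = orbitPoint (s * g) :=
  Subtype.ext (smul_smul s g (originSet k K))

theorem orbitPoint_le_iff {g h : K ≃ₐ[k] K} :
    orbitPoint h ≤ orbitPoint g ↔ Dominates (g⁻¹ * h) := by
  change h • originSet k K ⊆ g • originSet k K ↔ _
  rw [Set.subset_smul_set_iff, smul_smul]
  exact Set.image_subset_iff

theorem smul_le_smul_orbit {a b : OriginOrbit k K} (s : K ≃ₐ[k] K) (h : a ≤ b) :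
    s • a ≤ s • b := Set.smul_set_mono h

theorem smul_lt_smul_orbit {a b : OriginOrbit k K} (s : K ≃ₐ[k] K) (h : a < b) :
    s • a < s • b := by
  refine lt_of_le_not_ge (smul_le_smul_orbit s h.le) fun h1 => h.not_ge ?_
  simpa using smul_le_smul_orbit s⁻¹ h1

theorem orbitPoint_lt_mul_childAut (g : K ≃ₐ[k] K) (c : Option k) :
    orbitPoint g < orbitPoint (g * childAut K c) := by
  refine lt_of_le_not_ge (orbitPoint_le_iff.mpr ?_) fun h => ?_
  · rw [mul_inv_rev, inv_mul_cancel_right]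
    exact dominates_childAut_symm c
  · rw [orbitPoint_le_iff, inv_mul_cancel_left] at h
    exact not_dominates_childAut c h

theorem exists_mul_childAut_le {g h : K ≃ₐ[k] K} (hlt : orbitPoint h < orbitPoint g) :
    ∃ c, orbitPoint (h * childAut K c) ≤ orbitPoint g := by
  have h1 := orbitPoint_le_iff.mp hlt.le
  have h2 : ¬ Dominates (g⁻¹ * h)⁻¹ := by
    rw [mul_inv_rev, inv_inv]
    exact fun h3 => hlt.not_ge (orbitPoint_le_iff.mpr h3)
  obtain ⟨c, hc⟩ := h1.exists_dominates_mul_childAut h2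
  exact ⟨c, orbitPoint_le_iff.mpr (by rwa [← mul_assoc])⟩

theorem eq_of_mul_childAut_le {g h : K ≃ₐ[k] K} {c c' : Option k}
    (hc : orbitPoint (h * childAut K c) ≤ orbitPoint g)
    (hc' : orbitPoint (h * childAut K c') ≤ orbitPoint g) : c = c' := by
  rw [orbitPoint_le_iff, ← mul_assoc] at hc hc'
  exact eq_of_dominates_childAut hc hc'

theorem eq_of_rootAut_le {b : OriginOrbit k K} {r r' : Option k × Option k}
    (hr : orbitPoint (rootAut K r) ≤ b) (hr' : orbitPoint (rootAut K r') ≤ b) : r = r' := by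
  obtain ⟨g, rfl⟩ := exists_eq_orbitPoint b
  rw [orbitPoint_le_iff] at hr hr'
  exact eq_of_dominates_rootAut hr hr'

theorem Icc_orbitPoint_aux (n : ℕ) (h : K ≃ₐ[k] K)
    (hX : DeterminedAfter k n (h⁻¹ (ratX k K))) (hY : DeterminedAfter k n (h⁻¹ (ratY k K))) :
    (Set.Icc (orbitPoint h) (orbitPoint 1)).Finite ∧
      ∀ a ∈ Set.Icc (orbitPoint h) (orbitPoint 1), ∀ b ∈ Set.Icc (orbitPoint h) (orbitPoint 1),
        a ≤ b ∨ b ≤ a := by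
  induction n generalizing h with
  | zero =>
    by_cases hle : orbitPoint h ≤ orbitPoint 1
    · have h1 : Dominates h := by simpa using orbitPoint_le_iff.mp hle
      have h2 : orbitPoint (1 : K ≃ₐ[k] K) ≤ orbitPoint h := by
        rw [orbitPoint_le_iff, mul_one]
        exact h1.inv_of_determined hX hY
      rw [le_antisymm hle h2, Set.Icc_self]
      refine ⟨Set.finite_singleton _, ?_⟩
      rintro a rfl b rfl
      exact Or.inl le_rfl
    · rw [Set.Icc_eq_empty hle]
      exact ⟨Set.finite_empty, fun a ha => ha.elim⟩
  | succ n ih =>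
    have hmul : ∀ (c : Option k) (z : K), (h * childAut K c)⁻¹ z = (childAut K c).symm (h⁻¹ z) := fun c z => by
      rw [mul_inv_rev]; rfl
    have key : ∃ c, Set.Icc (orbitPoint h) (orbitPoint 1) ⊆ insert (orbitPoint h)
        (Set.Icc (orbitPoint (h * childAut K c)) (orbitPoint 1)) := by
      by_cases hlt : orbitPoint h < orbitPoint 1
      · obtain ⟨c, hc⟩ := exists_mul_childAut_le hlt
        refine ⟨c, fun a ha => ?_⟩
        rcases eq_or_lt_of_le ha.1 with h1 | h1
        · exact Or.inl h1.symm
        · right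
          obtain ⟨g, rfl⟩ := exists_eq_orbitPoint a
          obtain ⟨c', hc'⟩ := exists_mul_childAut_le h1
          rw [eq_of_mul_childAut_le hc (hc'.trans ha.2)]
          exact ⟨hc', ha.2⟩
      · refine ⟨none, fun a ha => Or.inl ?_⟩
        by_contra hne
        exact hlt (lt_of_lt_of_le (lt_of_le_of_ne ha.1 (Ne.symm hne)) ha.2)
    obtain ⟨c, hc⟩ := key
    obtain ⟨h1, h2⟩ := ih (h * childAut K c) (hmul c _ ▸ hX c) (hmul c _ ▸ hY c)
    refine ⟨(h1.insert _).subset hc, fun a ha b hb => ?_⟩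
    rcases hc ha with rfl | ha'
    · exact Or.inl hb.1
    rcases hc hb with rfl | hb'
    · exact Or.inr ha.1
    exact h2 a ha' b hb'

theorem Icc_orbitPoint (a b : OriginOrbit k K) : (Set.Icc a b).Finite ∧
    ∀ x ∈ Set.Icc a b, ∀ y ∈ Set.Icc a b, x ≤ y ∨ y ≤ x := by
  obtain ⟨h, rfl⟩ := exists_eq_orbitPoint a
  obtain ⟨g, rfl⟩ := exists_eq_orbitPoint b
  obtain ⟨n, hn⟩ := exists_determinedAfter (k := k) ((g⁻¹ * h)⁻¹ (ratX k K))
  obtain ⟨m, hm⟩ := exists_determinedAfter (k := k) ((g⁻¹ * h)⁻¹ (ratY k K))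
  obtain ⟨h1, h2⟩ := Icc_orbitPoint_aux (max n m) (g⁻¹ * h) (hn.mono (le_max_left _ _))
    (hm.mono (le_max_right _ _))
  have key : ∀ x ∈ Set.Icc (orbitPoint h) (orbitPoint g),
      g⁻¹ • x ∈ Set.Icc (orbitPoint (g⁻¹ * h)) (orbitPoint 1) := by
    intro x hx
    rw [← smul_orbitPoint, ← inv_mul_cancel g, ← smul_orbitPoint g⁻¹ g]
    exact ⟨smul_le_smul_orbit _ hx.1, smul_le_smul_orbit _ hx.2⟩
  refine ⟨(h1.preimage ((MulAction.injective (α := K ≃ₐ[k] K) g⁻¹).injOn)).subset key,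
    fun x hx y hy => ?_⟩
  refine (h2 _ (key x hx) _ (key y hy)).imp ?_ ?_ <;>
  · intro h3
    simpa using smul_le_smul_orbit g h3

theorem finite_not_determined [Finite k] (n : ℕ) (h : K ≃ₐ[k] K) (f : K)
    (hf : DeterminedAfter k n (h⁻¹ f)) :
    {b : OriginOrbit k K | ∃ g, b = orbitPoint g ∧ orbitPoint h ≤ orbitPoint g ∧
      ¬ Determined k (g⁻¹ f)}.Finite := by
  induction n generalizing h with
  | zero =>
    convert Set.finite_empty
    ext b
    simp only [Set.mem_ofPred_eq, Set.mem_empty_iff_false, iff_false]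
    rintro ⟨g, rfl, hle, hd⟩
    refine hd ?_
    have h1 := (orbitPoint_le_iff.mp hle).determined hf
    have h2 : h (h⁻¹ f) = f := h.apply_symm_apply f
    rwa [AlgEquiv.mul_apply, h2] at h1
  | succ n ih =>
    have hmul : ∀ (c : Option k) (z : K), (h * childAut K c)⁻¹ z = (childAut K c).symm (h⁻¹ z) := fun c z => by
      rw [mul_inv_rev]; rfl
    refine ((Set.finite_iUnion fun c : Option k =>
      ih (h * childAut K c) (hmul c _ ▸ hf c)).insert (orbitPoint h)).subset ?_
    rintro b ⟨g, rfl, hle, hd⟩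
    rcases eq_or_lt_of_le hle with h1 | h1
    · exact Or.inl h1.symm
    · obtain ⟨c, hc⟩ := exists_mul_childAut_le h1
      exact Or.inr (Set.mem_iUnion.mpr ⟨c, g, rfl, hc, hd⟩)

variable (k K) in
/-- The points of the orbit that are infinitely near to a closed point of `ℙ¹ × ℙ¹`. -/
def bubbleSet : Set (OriginOrbit k K) := {b | ∃ r, orbitPoint (rootAut K r) ≤ b}

theorem isUpperSet_bubbleSet : IsUpperSet (bubbleSet k K) :=
  fun _ _ hab ⟨r, hr⟩ => ⟨r, hr.trans hab⟩

theorem infinite_bubbleSet : (bubbleSet k K).Infinite := by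
  have hmono : StrictMono fun n : ℕ =>
      orbitPoint (rootAut K (none, none) * childAut K (none : Option k) ^ n) := by
    refine strictMono_nat_of_lt_succ fun n => ?_
    rw [pow_succ, ← mul_assoc]
    exact orbitPoint_lt_mul_childAut _ _
  refine (Set.infinite_range_of_injective hmono.injective).mono ?_
  rintro _ ⟨n, rfl⟩
  exact ⟨(none, none), by simpa using hmono.monotone (Nat.zero_le n)⟩

theorem setOf_mem_bubbleSet_le {b : OriginOrbit k K} {r : Option k × Option k}
    (hr : orbitPoint (rootAut K r) ≤ b) :
    {a ∈ bubbleSet k K | a ≤ b} = Set.Icc (orbitPoint (rootAut K r)) b := by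
  ext a
  constructor
  · rintro ⟨⟨r', hr'⟩, hab⟩
    rw [eq_of_rootAut_le hr (hr'.trans hab)]
    exact ⟨hr', hab⟩
  · exact fun ha => ⟨⟨r, ha.1⟩, ha.2⟩

theorem finite_mem_bubbleSet_le {b : OriginOrbit k K} (hb : b ∈ bubbleSet k K) :
    {a ∈ bubbleSet k K | a ≤ b}.Finite := by
  obtain ⟨r, hr⟩ := hb
  rw [setOf_mem_bubbleSet_le hr]
  exact (Icc_orbitPoint _ _).1

theorem exists_predecessor {b : OriginOrbit k K} (hb : b ∈ bubbleSet k K)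
    (hroot : ∀ r, b ≠ orbitPoint (rootAut K r)) :
    ∃ a ∈ bubbleSet k K, a < b ∧
      ∀ g, a = orbitPoint g → ∃ c, b = orbitPoint (g * childAut K c) := by
  have hfin : {a ∈ bubbleSet k K | a < b}.Finite :=
    (finite_mem_bubbleSet_le hb).subset fun a ha => ⟨ha.1, ha.2.le⟩
  obtain ⟨r, hr⟩ := hb
  obtain ⟨a, ha⟩ := hfin.exists_maximal ⟨orbitPoint (rootAut K r), ⟨r, le_rfl⟩,
    lt_of_le_of_ne hr (hroot r).symm⟩
  obtain ⟨g, rfl⟩ := exists_eq_orbitPoint b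
  refine ⟨a, ha.prop.1, ha.prop.2, ?_⟩
  rintro h rfl
  obtain ⟨c, hc⟩ := exists_mul_childAut_le ha.prop.2
  refine ⟨c, ?_⟩
  by_contra hne
  have hlt := orbitPoint_lt_mul_childAut h c
  exact ha.not_prop_of_gt hlt
    ⟨isUpperSet_bubbleSet hlt.le ha.prop.1, lt_of_le_of_ne hc (Ne.symm hne)⟩

theorem finite_level_bubbleSet [Finite k] (n : ℕ) :
    {b ∈ bubbleSet k K | {a ∈ bubbleSet k K | a ≤ b}.ncard ≤ n}.Finite := by
  induction n with
  | zero =>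
    convert Set.finite_empty
    ext b
    simp only [Set.mem_ofPred_eq, Set.mem_empty_iff_false, iff_false]
    rintro ⟨hb, hb'⟩
    have h1 := (Set.ncard_eq_zero (finite_mem_bubbleSet_le hb)).mp (Nat.le_zero.mp hb')
    exact (h1 ▸ (⟨hb, le_rfl⟩ : b ∈ {a ∈ bubbleSet k K | a ≤ b}) : b ∈ (∅ : Set _))
  | succ n ih =>
    choose φ hφ using exists_eq_orbitPoint (k := k) (K := K)
    refine ((Set.finite_range fun r => orbitPoint (rootAut K r)).union
      (Set.finite_iUnion fun c : Option k =>
        ih.image fun a => orbitPoint (φ a * childAut K c))).subset ?_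
    rintro b ⟨hb, hb'⟩
    by_cases hroot : ∃ r, b = orbitPoint (rootAut K r)
    · obtain ⟨r, rfl⟩ := hroot
      exact Or.inl ⟨r, rfl⟩
    · push Not at hroot
      obtain ⟨a, ha, hab, hch⟩ := exists_predecessor hb hroot
      obtain ⟨c, hc⟩ := hch (φ a) (hφ a)
      refine Or.inr (Set.mem_iUnion.mpr ⟨c, a, ⟨ha, ?_⟩, hc.symm⟩)
      refine Nat.le_of_lt_succ ((Set.ncard_lt_ncard ?_ (finite_mem_bubbleSet_le hb)).trans_le hb')
      refine ⟨fun x hx => ⟨hx.1, hx.2.trans hab.le⟩, fun hsub => ?_⟩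
      exact (hsub (⟨hb, le_rfl⟩ : b ∈ {a ∈ bubbleSet k K | a ≤ b})).2.not_gt hab

theorem finite_smul_notMem_bubbleSet [Finite k] (s : K ≃ₐ[k] K) :
    {b ∈ bubbleSet k K | s • b ∉ bubbleSet k K}.Finite := by
  have hfin : ∀ (r : Option k × Option k) (f : K), {b : OriginOrbit k K | ∃ g, b = orbitPoint g ∧
      orbitPoint (rootAut K r) ≤ orbitPoint g ∧ ¬ Determined k (g⁻¹ f)}.Finite := by
    intro r f
    obtain ⟨n, hn⟩ := exists_determinedAfter (k := k) ((rootAut K r)⁻¹ f)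
    exact finite_not_determined n _ f hn
  refine (Set.finite_iUnion fun r : Option k × Option k =>
    (hfin r (s⁻¹ (ratX k K))).union (hfin r (s⁻¹ (ratY k K)))).subset ?_
  rintro b ⟨⟨r, hr⟩, hsb⟩
  obtain ⟨g, rfl⟩ := exists_eq_orbitPoint b
  rw [Set.mem_iUnion]
  refine ⟨r, ?_⟩
  by_cases hX : Determined k (g⁻¹ (s⁻¹ (ratX k K)))
  · by_cases hY : Determined k (g⁻¹ (s⁻¹ (ratY k K)))
    · refine (hsb ?_).elim
      obtain ⟨r', hr'⟩ := exists_dominates_rootAut (h := (s * g)⁻¹)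
        (by rw [mul_inv_rev]; exact hX) (by rw [mul_inv_rev]; exact hY)
      exact ⟨r', by rwa [smul_orbitPoint, orbitPoint_le_iff]⟩
    · exact Or.inr ⟨g, rfl, hr, hY⟩
  · exact Or.inl ⟨g, rfl, hr, hX⟩

theorem not_lt_smul_of_isOfFinOrder {s : K ≃ₐ[k] K} (hs : IsOfFinOrder s) (a : OriginOrbit k K) :
    ¬ a < s • a := by
  intro h
  have key : ∀ n : ℕ, a < s ^ (n + 1) • a := by
    intro n
    induction n with
    | zero => simpa using h
    | succ n ih =>
      rw [pow_succ', mul_smul]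
      exact h.trans (smul_lt_smul_orbit s ih)
  obtain ⟨n, hn, h1⟩ := isOfFinOrder_iff_pow_eq_one.mp hs
  obtain ⟨m, rfl⟩ := Nat.exists_eq_succ_of_ne_zero hn.ne'
  exact absurd (key m) (by rw [h1, one_smul]; exact lt_irrefl a)

theorem exists_finite_orbit_orbitPoint [Finite k] (G : Subgroup (K ≃ₐ[k] K)) (hG : Group.FG G)
    (htor : ∀ g : G, IsOfFinOrder g) :
    ∃ g : K ≃ₐ[k] K, (MulAction.orbit G (orbitPoint g)).Finite := by
  obtain ⟨b, -, hb⟩ := exists_finite_orbit (G := G) (fun g _ _ h => smul_le_smul_orbit (g : _) h)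
    (fun g a => not_lt_smul_of_isOfFinOrder ((Submonoid.isOfFinOrder_coe (H := G.toSubmonoid)).mpr (htor g)) a) hG
    (bubbleSet k K) isUpperSet_bubbleSet infinite_bubbleSet (fun b hb => finite_mem_bubbleSet_le hb)
    (by
      rintro b ⟨r, hr⟩ a ha c hc hab hcb
      have h1 := setOf_mem_bubbleSet_le hr
      exact (Icc_orbitPoint _ b).2 a (h1.subset ⟨ha, hab⟩) c (h1.subset ⟨hc, hcb⟩))
    finite_level_bubbleSet (fun g => finite_smul_notMem_bubbleSet (g : K ≃ₐ[k] K))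
  obtain ⟨g, rfl⟩ := exists_eq_orbitPoint b
  exact ⟨g, hb⟩

end Points

section LocalUnipotent

open IsLocalRing

variable {A : Type*} [CommRing A] [IsLocalRing A]

theorem map_sub_self_mem_pow_succ {σ : A ≃+* A} {S : Set A}
    (h0 : ∀ a, σ a - a ∈ maximalIdeal A) (hS : maximalIdeal A = Ideal.span S)
    (h1 : ∀ s ∈ S, σ s - s ∈ maximalIdeal A ^ 2) (i : ℕ) :
    ∀ a ∈ maximalIdeal A ^ i, σ a - a ∈ maximalIdeal A ^ (i + 1) := by
  have hm : ∀ a ∈ maximalIdeal A, σ a - a ∈ maximalIdeal A ^ 2 := by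
    intro a ha
    rw [hS] at ha
    induction ha using Submodule.span_induction with
    | mem s hs => exact h1 s hs
    | zero => simp
    | add x y _ _ hx hy => rw [map_add, add_sub_add_comm]; exact add_mem hx hy
    | smul c x hx ih =>
      have hx : x ∈ maximalIdeal A := by rw [hS]; exact hx
      have h2 : σ (c • x) - c • x = σ c * (σ x - x) + (σ c - c) * x := by
        rw [smul_eq_mul, map_mul]; ring
      rw [h2]
      refine add_mem (Ideal.mul_mem_left _ _ ih) ?_
      rw [pow_two]
      exact Ideal.mul_mem_mul (h0 c) hx
  induction i with
  | zero => simpa using h0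
  | succ i ih =>
    intro a ha
    rw [pow_succ] at ha
    induction ha using Submodule.mul_induction_on' with
    | mem_mul_mem a ha b hb =>
      have h2 : σ (a * b) - a * b = σ a * (σ b - b) + (σ a - a) * b := by
        rw [map_mul]; ring
      have h3 : σ a ∈ maximalIdeal A ^ i := by
        have := add_mem (Ideal.pow_le_pow_right (Nat.le_succ i) (ih a ha)) ha
        rwa [sub_add_cancel] at this
      rw [h2]
      refine add_mem ?_ ?_
      · rw [add_assoc, pow_add]
        exact Ideal.mul_mem_mul h3 (hm b hb)
      · rw [pow_succ]
        exact Ideal.mul_mem_mul (ih a ha) hb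
    | add x _ y _ hx hy => rw [map_add, add_sub_add_comm]; exact add_mem hx hy

theorem pow_apply_sub_mem_pow_succ {σ : A ≃+* A}
    (h : ∀ i, ∀ a ∈ maximalIdeal A ^ i, σ a - a ∈ maximalIdeal A ^ (i + 1)) (n i : ℕ) :
    ∀ a ∈ maximalIdeal A ^ i, (σ ^ n) a - a ∈ maximalIdeal A ^ (i + 1) := by
  induction n with
  | zero => simp
  | succ n ih =>
    intro a ha
    have h3 : (σ ^ n) a ∈ maximalIdeal A ^ i := by
      have := add_mem (Ideal.pow_le_pow_right (Nat.le_succ i) (ih a ha)) ha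
      rwa [sub_add_cancel] at this
    rw [pow_succ' σ n, RingAut.mul_apply]
    have := add_mem (h i _ h3) (ih a ha)
    rwa [sub_add_sub_cancel] at this

theorem eq_one_of_pow_eq_one_of_unipotent [IsNoetherianRing A] {τ : A ≃+* A}
    (h : ∀ i, ∀ a ∈ maximalIdeal A ^ i, τ a - a ∈ maximalIdeal A ^ (i + 1)) {t : ℕ}
    (ht : IsUnit (t : A)) (hτ : τ ^ t = 1) : τ = 1 := by
  ext v
  have key : ∀ i, τ v - v ∈ maximalIdeal A ^ i := by
    intro i
    induction i with
    | zero => simp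
    | succ i ih =>
      have h2 : ∀ l : ℕ, (τ ^ l) v - v - l * (τ v - v) ∈ maximalIdeal A ^ (i + 1) := by
        intro l
        induction l with
        | zero => simp
        | succ l ihl =>
          have h3 : (τ ^ l) v - v ∈ maximalIdeal A ^ i := by
            have := add_mem (Ideal.pow_le_pow_right (Nat.le_succ i) ihl)
              (Ideal.mul_mem_left _ (l : A) ih)
            rwa [sub_add_cancel] at this
          have h4 := add_mem (h i _ h3) ihl
          convert h4 using 1
          rw [pow_succ', RingAut.mul_apply, map_sub]
          push_cast
          ring
      have h5 := h2 t
      rw [hτ, RingAut.one_apply, sub_self, zero_sub, neg_mem_iff] at h5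
      obtain ⟨u, hu⟩ := ht
      rw [← hu] at h5
      simpa using Ideal.mul_mem_left _ (↑u⁻¹ : A) h5
  have hbot : τ v - v ∈ (⊥ : Ideal A) := by
    rw [← Ideal.iInf_pow_eq_bot_of_isLocalRing (maximalIdeal A) (maximalIdeal.isMaximal A).ne_top]
    exact Ideal.mem_iInf.mpr key
  simpa [sub_eq_zero] using hbot

theorem exists_pow_prime_pow_eq_one [IsNoetherianRing A] {p : ℕ} (hp : p.Prime)
    (hpA : (p : A) ∈ maximalIdeal A) {σ : A ≃+* A} {S : Set A}
    (h0 : ∀ a, σ a - a ∈ maximalIdeal A) (hS : maximalIdeal A = Ideal.span S)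
    (h1 : ∀ s ∈ S, σ s - s ∈ maximalIdeal A ^ 2) (hσ : IsOfFinOrder σ) :
    ∃ j, σ ^ p ^ j = 1 := by
  obtain ⟨n, hn, hσn⟩ := isOfFinOrder_iff_pow_eq_one.mp hσ
  obtain ⟨j, t, ht, rfl⟩ := Nat.exists_eq_pow_mul_and_not_dvd hn.ne' p hp.ne_one
  refine ⟨j, eq_one_of_pow_eq_one_of_unipotent (t := t)
    (fun i => pow_apply_sub_mem_pow_succ (map_sub_self_mem_pow_succ h0 hS h1) _ i) ?_
    (by rw [← pow_mul, hσn])⟩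
  by_contra hu
  have h2 : (t : A) ∈ maximalIdeal A := hu
  have h3 := (Nat.Coprime.isCoprime ((Nat.Prime.coprime_iff_not_dvd hp).mpr ht))
  obtain ⟨a, b, hab⟩ := h3.map (Int.castRingHom A)
  simp only [eq_intCast, Int.cast_natCast] at hab
  exact (Ideal.ne_top_iff_one _).mp (maximalIdeal.isMaximal A).ne_top
    (hab ▸ add_mem (Ideal.mul_mem_left _ _ hpA) (Ideal.mul_mem_left _ _ h2))

theorem exists_finiteIndex_pow_prime_pow_eq_one [IsNoetherianRing A] [Finite (ResidueField A)]
    {p : ℕ} (hp : p.Prime) (hpA : (p : A) ∈ maximalIdeal A) {H : Type*} [Group H]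
    (ψ : H →* (A ≃+* A)) (hψ : ∀ h, IsOfFinOrder (ψ h)) :
    ∃ N : Subgroup H, N.FiniteIndex ∧ ∀ h ∈ N, ∃ j, ψ h ^ p ^ j = 1 := by
  have hfin : Finite (A ⧸ maximalIdeal A) := inferInstanceAs (Finite (ResidueField A))
  have hfin2 : Finite (A ⧸ maximalIdeal A ^ 2) :=
    Ideal.finite_quotient_pow (IsNoetherian.noetherian _) 2
  have hmap : ∀ σ : A ≃+* A, ∀ a ∈ maximalIdeal A ^ 2, σ a ∈ maximalIdeal A ^ 2 := by
    intro σ a ha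
    have h1 := Ideal.mem_map_of_mem (σ : A →+* A) ha
    rw [Ideal.map_pow] at h1
    refine Ideal.pow_right_mono ?_ 2 h1
    rw [Ideal.map_le_iff_le_comap]
    intro x hx hu
    exact hx ((MulEquiv.isUnit_map σ).mp hu)
  let φ : H →* Equiv.Perm (A ⧸ maximalIdeal A ^ 2) := MonoidHom.mk' (fun h =>
    (Ideal.quotientEquiv (maximalIdeal A ^ 2) (maximalIdeal A ^ 2) (ψ h) (by
      apply le_antisymm
      · intro a ha
        exact (Ideal.mem_map_iff_of_surjective ((ψ h : A ≃+* A) : A →+* A)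
          (ψ h).surjective).mpr ⟨(ψ h).symm a, hmap _ a ha, (ψ h).apply_symm_apply a⟩
      · rw [Ideal.map_le_iff_le_comap]
        exact hmap (ψ h))).toEquiv) (by
      intro a b
      ext x
      obtain ⟨x, rfl⟩ := Ideal.Quotient.mk_surjective x
      simp)
  refine ⟨φ.ker, inferInstance, fun h hh => ?_⟩
  have h2 : ∀ a, ψ h a - a ∈ maximalIdeal A ^ 2 := by
    intro a
    have h3 := Equiv.congr_fun hh (Ideal.Quotient.mk _ a)
    rw [← Ideal.Quotient.eq]
    exact h3
  exact exists_pow_prime_pow_eq_one hp hpA (S := maximalIdeal A)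
    (fun a => Ideal.pow_le_self two_ne_zero (h2 a)) (Ideal.span_eq _).symm (fun a _ => h2 a) (hψ h)

end LocalUnipotent

section Restriction

theorem exists_restrict_ringAut {A K D : Type*} [CommRing A] [CommRing K] [Group D]
    (θ : D →* (K ≃+* K)) {ι : A →+* K} (hι : Function.Injective ι)
    (h : ∀ (g : D) (a : A), ∃ b, ι b = θ g (ι a)) :
    ∃ ψ : D →* (A ≃+* A), ∀ g a, ι (ψ g a) = θ g (ι a) := by
  choose f hf using h
  let _ : MulSemiringAction D A :=
    { smul := f
      one_smul := fun a => hι (by change ι (f 1 a) = _; rw [hf, map_one, RingAut.one_apply])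
      mul_smul := fun g g' a => hι (by
        change ι (f (g * g') a) = ι (f g (f g' a))
        rw [hf, hf, hf, map_mul, RingAut.mul_apply])
      smul_zero := fun g => hι (by change ι (f g 0) = _; rw [hf, map_zero, map_zero])
      smul_one := fun g => hι (by change ι (f g 1) = _; rw [hf, map_one, map_one])
      smul_add := fun g a b => hι (by
        change ι (f g (a + b)) = ι (f g a + f g b)
        rw [hf, map_add, map_add, map_add, hf, hf])
      smul_mul := fun g a b => hι (by
        change ι (f g (a * b)) = ι (f g a * f g b)
        rw [hf, map_mul, map_mul, map_mul, hf, hf]) }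
  exact ⟨MulSemiringAction.toRingAut D A, hf⟩

end Restriction

section PositiveCharacteristic

set_option linter.unusedSectionVars false

open IsLocalRing MvPolynomial
open scoped Pointwise

variable {k K : Type*} [Field k] [Field K] [Algebra (MvPolynomial (Fin 2) k) K]
  [IsFractionRing (MvPolynomial (Fin 2) k) K] [Algebra k K]
  [IsScalarTower k (MvPolynomial (Fin 2) k) K]

theorem algEquiv_ext_rat {g h : K ≃ₐ[k] K} (hX : g (ratX k K) = h (ratX k K))
    (hY : g (ratY k K) = h (ratY k K)) : g = h := by
  have h1 : ∀ f : MvPolynomial (Fin 2) k,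
      g (algebraMap _ K f) = h (algebraMap _ K f) := by
    intro f
    have h2 := algHom_algebraMap (k := k) (K := K) (g : K →ₐ[k] K) f
    have h3 := algHom_algebraMap (k := k) (K := K) (h : K →ₐ[k] K) f
    rw [AlgEquiv.coe_toAlgHom] at h2 h3
    rw [h2, h3, hX, hY]
  ext z
  obtain ⟨a, b, -, rfl⟩ := IsFractionRing.div_surjective (A := MvPolynomial (Fin 2) k) z
  rw [map_div₀, map_div₀, h1, h1]

variable (k K) in
theorem finite_residueField_originRing [Finite k] : Finite (ResidueField (originRing k K)) := by
  refine Finite.of_surjective (fun c : k => residue _ (algebraMap k (originRing k K) c)) ?_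
  intro z
  obtain ⟨z, rfl⟩ := residue_surjective z
  obtain ⟨c, hc⟩ := exists_sub_algebraMap_mem_maximalIdeal z
  refine ⟨c, ?_⟩
  rw [eq_comm, ← sub_eq_zero, ← map_sub]
  exact (residue_eq_zero_iff _).mpr hc

theorem exists_finiteIndex_pow_prime_pow_eq_one_of_finite [Finite k] {p : ℕ} (hp : p.Prime)
    (hpk : (p : k) = 0) {G : Type*} [Group G] [Group.FG G] (htor : ∀ g : G, IsOfFinOrder g)
    (φ : G →* (K ≃ₐ[k] K)) :
    ∃ N : Subgroup G, N.FiniteIndex ∧ ∀ g ∈ N, ∃ j, φ g ^ p ^ j = 1 := by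
  obtain ⟨g₀, hg₀⟩ := exists_finite_orbit_orbitPoint φ.range inferInstance (by
    rintro ⟨_, g, rfl⟩
    have := (φ.rangeRestrict).isOfFinOrder (htor g)
    exact this)
  let H : Subgroup G := (MulAction.stabilizer φ.range (orbitPoint g₀)).comap φ.rangeRestrict
  have hfin : (MulAction.stabilizer φ.range (orbitPoint g₀)).FiniteIndex := by
    have := hg₀.to_subtype
    refine ⟨?_⟩
    rw [MulAction.index_stabilizer]
    exact Set.ncard_ne_zero_of_mem (MulAction.mem_orbit_self _) hg₀
  have hH : H.FiniteIndex := by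
    refine ⟨?_⟩
    rw [Subgroup.index_comap_of_surjective _ φ.rangeRestrict_surjective]
    exact hfin.index_ne_zero
  have hfix : ∀ h ∈ H, Dominates (g₀⁻¹ * φ h * g₀) := by
    intro h hh
    have h1 : φ h • orbitPoint g₀ = orbitPoint g₀ := hh
    rw [mul_assoc, ← orbitPoint_le_iff, ← smul_orbitPoint, h1]
  let θ : H →* (K ≃+* K) := (MulSemiringAction.toRingAut (K ≃ₐ[k] K) K).comp
    ((MulAut.conj g₀⁻¹).toMonoidHom.comp (φ.comp H.subtype))
  have hθ : ∀ (h : H) z, θ h z = (g₀⁻¹ * φ h * g₀) z := by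
    intro h z
    change (g₀⁻¹ * φ h * g₀⁻¹⁻¹) z = _
    rw [inv_inv]
  obtain ⟨ψ, hψ⟩ := exists_restrict_ringAut θ (ι := algebraMap (originRing k K) K)
    Subtype.val_injective (fun h a => ⟨⟨θ h a, by
      rw [hθ]
      exact (hfix h h.2).map_originRing a.2⟩, rfl⟩)
  have := finite_residueField_originRing k K
  obtain ⟨N, hN, hNp⟩ := exists_finiteIndex_pow_prime_pow_eq_one (A := originRing k K) hp
    (by
      rw [← map_natCast (algebraMap k (originRing k K)), hpk, map_zero]
      exact zero_mem _) ψ (fun h => ψ.isOfFinOrder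
        ((Submonoid.isOfFinOrder_coe (H := H.toSubmonoid)).mp (htor h)))
  refine ⟨N.map H.subtype, ⟨?_⟩, ?_⟩
  · rw [Subgroup.index_map_subtype]
    exact mul_ne_zero hN.index_ne_zero hH.index_ne_zero
  · rintro _ ⟨h, hh, rfl⟩
    obtain ⟨j, hj⟩ := hNp h hh
    refine ⟨j, ?_⟩
    have key : ∀ z : originRing k K, (g₀⁻¹ * φ (h ^ p ^ j) * g₀) z = (z : K) := by
      intro z
      have h2 := hψ (h ^ p ^ j) z
      rw [map_pow, hj, hθ] at h2
      exact h2.symm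
    have h3 : g₀⁻¹ * φ (h ^ p ^ j) * g₀ = 1 :=
      algEquiv_ext_rat (key ⟨_, mem_originRing_of_mem_originSet ratX_mem⟩)
        (key ⟨_, mem_originRing_of_mem_originSet ratY_mem⟩)
    have h4 : φ ((h : G) ^ p ^ j) = 1 := by
      rw [mul_assoc, inv_mul_eq_one] at h3
      exact right_eq_mul.mp h3
    rw [← h4, map_pow]; rfl

end PositiveCharacteristic

section Specialization

set_option linter.unusedSectionVars false

open IsLocalRing MvPolynomial

variable {R F : Type*} [CommRing R] [Field F] (π : R →+* F)

/-- The polynomials over `R` whose specialization along `π` vanishes. -/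
abbrev specIdeal : Ideal (MvPolynomial (Fin 2) R) :=
  RingHom.ker (map π : MvPolynomial (Fin 2) R →+* MvPolynomial (Fin 2) F)

instance : (specIdeal π).IsPrime := RingHom.ker_isPrime _

/-- The ring of rational functions that can be specialized along `π`. -/
abbrev SpecRing : Type _ := Localization.AtPrime (specIdeal π)

/-- Specialization of rational functions along `π`. -/
def specMap : SpecRing π →+* FractionRing (MvPolynomial (Fin 2) F) :=
  IsLocalization.lift (M := (specIdeal π).primeCompl)
    (g := (algebraMap (MvPolynomial (Fin 2) F) (FractionRing (MvPolynomial (Fin 2) F))).comp (map π))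
    (fun f => by
      rw [isUnit_iff_ne_zero, RingHom.comp_apply, map_ne_zero_iff _ (IsFractionRing.injective _ _)]
      exact f.2)

theorem specMap_algebraMap (f : MvPolynomial (Fin 2) R) :
    specMap π (algebraMap _ _ f) = algebraMap _ _ (map π f) :=
  IsLocalization.lift_eq _ _

variable {π} in
theorem specMap_surjective (hπ : Function.Surjective π) : Function.Surjective (specMap π) := by
  intro z
  obtain ⟨a, b, hb, rfl⟩ := IsFractionRing.div_surjective (A := MvPolynomial (Fin 2) F) z
  obtain ⟨a, rfl⟩ := map_surjective π hπ a
  obtain ⟨b, rfl⟩ := map_surjective π hπ b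
  have hb' : b ∈ (specIdeal π).primeCompl := nonZeroDivisors.ne_zero hb
  refine ⟨IsLocalization.mk' _ a ⟨b, hb'⟩, ?_⟩
  rw [eq_div_iff (by simpa using nonZeroDivisors.ne_zero hb), ← specMap_algebraMap,
    ← specMap_algebraMap, ← map_mul]
  congr 1
  exact IsLocalization.mk'_spec _ a ⟨b, hb'⟩

variable {π} in
theorem specMap_eq_zero_iff (hπ : Function.Surjective π) {z : SpecRing π} :
    specMap π z = 0 ↔ z ∈ maximalIdeal (SpecRing π) := by
  rw [← eq_maximalIdeal (RingHom.ker_isMaximal_of_surjective _ (specMap_surjective hπ)),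
    RingHom.mem_ker]

theorem maximalIdeal_specRing_eq : maximalIdeal (SpecRing π) =
    Ideal.span ((fun r => algebraMap (MvPolynomial (Fin 2) R) (SpecRing π) (C r)) ''
      (RingHom.ker π : Set R)) := by
  have h1 : specIdeal π = (RingHom.ker π).map C := ker_map π
  rw [← IsLocalization.AtPrime.map_eq_maximalIdeal (specIdeal π) (SpecRing π)]
  refine (congrArg (Ideal.map (algebraMap _ (SpecRing π))) h1).trans ?_
  rw [Ideal.map_map]
  rfl

variable {k K : Type*} [Field k] [Field K] [Algebra (MvPolynomial (Fin 2) k) K]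
  [IsFractionRing (MvPolynomial (Fin 2) k) K] [Algebra k K]
  [IsScalarTower k (MvPolynomial (Fin 2) k) K] [Algebra R k] [FaithfulSMul R k]

variable (R k K) in
/-- A polynomial over `R` as a rational function over `k`. -/
def polyMap : MvPolynomial (Fin 2) R →+* K :=
  (algebraMap (MvPolynomial (Fin 2) k) K).comp (map (algebraMap R k))

variable (R k K) in
theorem polyMap_injective : Function.Injective (polyMap R k K) :=
  (IsFractionRing.injective (MvPolynomial (Fin 2) k) K).comp
    (map_injective _ (FaithfulSMul.algebraMap_injective R k))

theorem polyMap_C (r : R) : polyMap R k K (C r) = algebraMap k K (algebraMap R k r) := by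
  rw [polyMap, RingHom.comp_apply, map_C, ← algebraMap_eq, ← IsScalarTower.algebraMap_apply]

variable (k K) in
/-- The inclusion of the specializable rational functions in the field of rational functions. -/
def genMap : SpecRing π →+* K :=
  IsLocalization.lift (M := (specIdeal π).primeCompl) (g := polyMap R k K)
    (fun f => by
      rw [isUnit_iff_ne_zero, map_ne_zero_iff _ (polyMap_injective R k K)]
      intro h
      exact f.2 (by rw [h]; exact zero_mem _))

theorem genMap_algebraMap (f : MvPolynomial (Fin 2) R) :
    genMap π k K (algebraMap _ _ f) = polyMap R k K f :=
  IsLocalization.lift_eq _ _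

theorem genMap_injective : Function.Injective (genMap π k K) := by
  rw [injective_iff_map_eq_zero]
  intro z hz
  obtain ⟨a, b, rfl⟩ := IsLocalization.exists_mk'_eq (specIdeal π).primeCompl z
  have h1 : polyMap R k K a = 0 := by
    rw [← genMap_algebraMap π, ← IsLocalization.mk'_spec (SpecRing π) a b, map_mul, hz, zero_mul]
  rw [map_eq_zero_iff _ (polyMap_injective R k K)] at h1
  rw [h1, IsLocalization.mk'_zero]

theorem exists_isUnit_genMap_eq_div {f g : MvPolynomial (Fin 2) R} (hf : map π f ≠ 0)
    (hg : map π g ≠ 0) :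
    ∃ w, IsUnit w ∧ genMap π k K w = polyMap R k K f / polyMap R k K g := by
  have hf' := IsLocalization.map_units (SpecRing π) (⟨f, hf⟩ : (specIdeal π).primeCompl)
  have hg' := IsLocalization.map_units (SpecRing π) (⟨g, hg⟩ : (specIdeal π).primeCompl)
  obtain ⟨c, hc⟩ := hg'
  refine ⟨algebraMap _ _ f * ↑c⁻¹, hf'.mul c⁻¹.isUnit, ?_⟩
  rw [map_mul, genMap_algebraMap, map_units_inv, hc, div_eq_mul_inv]
  congr 2
  exact genMap_algebraMap π g

variable (s : K ≃ₐ[k] K) {u v : SpecRing π}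

/-- Substitution of specializable rational functions in a polynomial. -/
def substMap (u v : SpecRing π) : MvPolynomial (Fin 2) R →+* SpecRing π :=
  eval₂Hom ((algebraMap (MvPolynomial (Fin 2) R) (SpecRing π)).comp C) ![u, v]

variable {s} in
theorem genMap_substMap (hu : genMap π k K u = s (ratX k K)) (hv : genMap π k K v = s (ratY k K))
    (q : MvPolynomial (Fin 2) R) : genMap π k K (substMap π u v q) = s (polyMap R k K q) := by
  have h : (genMap π k K).comp (substMap π u v) = (s : K →+* K).comp (polyMap R k K) := by
    refine ringHom_ext (fun r => ?_) (fun i => ?_)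
    · simp only [RingHom.comp_apply, substMap, eval₂Hom_C, genMap_algebraMap]
      rw [polyMap_C]
      exact (s.commutes _).symm
    · fin_cases i
      · simpa [substMap, polyMap, ratX] using hu
      · simpa [substMap, polyMap, ratY] using hv
  exact RingHom.congr_fun h q

theorem specMap_substMap (q : MvPolynomial (Fin 2) R) :
    specMap π (substMap π u v q) = aeval ![specMap π u, specMap π v] (map π q) := by
  have h : (specMap π).comp (substMap π u v) =
      ((aeval ![specMap π u, specMap π v] : MvPolynomial (Fin 2) F →ₐ[F] _) : _ →+* _).comp
        (map π) := by
    refine ringHom_ext (fun r => ?_) (fun i => ?_)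
    · simp only [RingHom.comp_apply, substMap, eval₂Hom_C, specMap_algebraMap]
      rw [map_C, RingHom.coe_coe, aeval_C, ← algebraMap_eq, ← IsScalarTower.algebraMap_apply]
    · fin_cases i <;> simp [substMap]
  exact RingHom.congr_fun h q

variable {s} {π}

theorem exists_genMap_eq_map (hπ : Function.Surjective π) (hu : genMap π k K u = s (ratX k K))
    (hv : genMap π k K v = s (ratY k K)) (hind : AlgebraicIndependent F ![specMap π u, specMap π v])
    (a : SpecRing π) : ∃ b, genMap π k K b = s (genMap π k K a) := by
  obtain ⟨n, d, rfl⟩ := IsLocalization.exists_mk'_eq (specIdeal π).primeCompl a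
  have hd : IsUnit (substMap π u v d) := by
    by_contra hd
    have h1 : specMap π (substMap π u v d) ≠ 0 := by
      rw [specMap_substMap]
      exact (map_ne_zero_iff _ hind).mpr d.2
    exact h1 ((specMap_eq_zero_iff hπ).mpr hd)
  obtain ⟨c, hc⟩ := hd
  refine ⟨substMap π u v n * ↑c⁻¹, ?_⟩
  have h1 := IsLocalization.mk'_spec (SpecRing π) n d
  apply_fun genMap π k K at h1
  rw [map_mul, genMap_algebraMap, genMap_algebraMap] at h1
  rw [map_mul, map_units_inv, hc, genMap_substMap π hu hv, genMap_substMap π hu hv, ← h1, map_mul]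
  refine mul_inv_cancel_right₀ ?_ _
  rw [map_ne_zero_iff _ s.injective, map_ne_zero_iff _ (polyMap_injective R k K)]
  intro h
  exact d.2 (by rw [h]; exact zero_mem _)

theorem mem_adjoin_of_substMap_mul_eq {N D z : MvPolynomial (Fin 2) R}
    (hD : IsUnit (substMap π u v D))
    (h : substMap π u v D * algebraMap _ _ z = substMap π u v N) :
    algebraMap _ _ (map π z) ∈ IntermediateField.adjoin F {specMap π u, specMap π v} := by
  have h1 : specMap π (substMap π u v D) ≠ 0 := (hD.map (specMap π)).ne_zero
  apply_fun specMap π at h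
  rw [map_mul, specMap_algebraMap, mul_comm] at h
  have h2 : ∀ q, specMap π (substMap π u v q) ∈
      IntermediateField.adjoin F {specMap π u, specMap π v} := by
    intro q
    rw [specMap_substMap]
    induction map π q using MvPolynomial.induction_on with
    | C c => rw [aeval_C]; exact algebraMap_mem _ c
    | add p q hp hq => rw [map_add]; exact add_mem hp hq
    | mul_X p i hp =>
      rw [map_mul, aeval_X]
      refine mul_mem hp (IntermediateField.subset_adjoin _ _ ?_)
      fin_cases i <;> simp
  rw [eq_div_of_mul_eq h1 h]
  exact div_mem (h2 _) (h2 _)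

end Specialization

section Restriction

theorem exists_quotient_ringAut {A B D : Type*} [CommRing A] [CommRing B] [Group D]
    (θ : D →* (A ≃+* A)) {ρ : A →+* B} (hρ : Function.Surjective ρ)
    (h : ∀ (g : D) (a : A), ρ a = 0 → ρ (θ g a) = 0) :
    ∃ ψ : D →* (B ≃+* B), ∀ g a, ψ g (ρ a) = ρ (θ g a) := by
  have hf : ∀ (g : D) (a : A), ρ (θ g (Function.surjInv hρ (ρ a))) = ρ (θ g a) := by
    intro g a
    rw [← sub_eq_zero, ← map_sub, ← map_sub]
    exact h g _ (by rw [map_sub, Function.surjInv_eq hρ, sub_self])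
  let _ : MulSemiringAction D B :=
    { smul := fun g b => ρ (θ g (Function.surjInv hρ b))
      one_smul := hρ.forall.mpr fun a => by
        change ρ (θ 1 _) = _; rw [hf, map_one, RingAut.one_apply]
      mul_smul := fun g g' => hρ.forall.mpr fun a => by
        change ρ (θ (g * g') _) = ρ (θ g (Function.surjInv hρ (ρ (θ g' _))))
        rw [hf, hf, map_mul, RingAut.mul_apply, ← sub_eq_zero, ← map_sub, ← map_sub]
        exact h g _ (by rw [map_sub, hf, sub_self])
      smul_zero := fun g => by
        change ρ (θ g (Function.surjInv hρ 0)) = 0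
        rw [← map_zero ρ, hf, map_zero]
      smul_one := fun g => by
        change ρ (θ g (Function.surjInv hρ 1)) = 1
        rw [← map_one ρ, hf, map_one]
      smul_add := fun g => hρ.forall.mpr fun a => hρ.forall.mpr fun b => by
        change ρ (θ g (Function.surjInv hρ (ρ a + ρ b))) = ρ (θ g _) + ρ (θ g _)
        rw [← map_add ρ, hf, hf, hf, map_add, map_add]
      smul_mul := fun g => hρ.forall.mpr fun a => hρ.forall.mpr fun b => by
        change ρ (θ g (Function.surjInv hρ (ρ a * ρ b))) = ρ (θ g _) * ρ (θ g _)
        rw [← map_mul ρ, hf, hf, hf, map_mul, map_mul] }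
  exact ⟨MulSemiringAction.toRingAut D B, hf⟩

end Restriction

section Reduction

set_option linter.unusedSectionVars false

open IsLocalRing MvPolynomial

variable {R F : Type*} [CommRing R] [Field F] {π : R →+* F}
variable {k K : Type*} [Field k] [Field K] [Algebra (MvPolynomial (Fin 2) k) K]
  [IsFractionRing (MvPolynomial (Fin 2) k) K] [Algebra k K]
  [IsScalarTower k (MvPolynomial (Fin 2) k) K] [Algebra R k] [FaithfulSMul R k]

theorem exists_finiteIndex_pow_prime_pow_eq_one_of_genMap [IsNoetherianRing R] [Finite F]
    (hπ : Function.Surjective π) {p : ℕ} (hp : p.Prime) (hpF : (p : F) = 0)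
    (G : Subgroup (K ≃ₐ[k] K)) [Group.FG G] (htor : ∀ g : G, IsOfFinOrder g)
    {S : Set G} (hS : Submonoid.closure S = ⊤)
    (hV : ∀ s ∈ S, ∀ a, ∃ b, genMap π k K b = (s : K ≃ₐ[k] K) (genMap π k K a)) :
    ∃ N : Subgroup G, N.FiniteIndex ∧ ∀ g ∈ N, ∃ j, g ^ p ^ j = 1 := by
  have hVG : ∀ (g : G) a, ∃ b, genMap π k K b = (g : K ≃ₐ[k] K) (genMap π k K a) := by
    intro g
    have hg : g ∈ Submonoid.closure S := by rw [hS]; trivial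
    induction hg using Submonoid.closure_induction with
    | mem s hs => exact hV s hs
    | one => exact fun a => ⟨a, rfl⟩
    | mul g h _ _ hg hh =>
      intro a
      obtain ⟨b, hb⟩ := hh a
      obtain ⟨c, hc⟩ := hg b
      exact ⟨c, by rw [hc, hb]; rfl⟩
  obtain ⟨ψ, hψ⟩ := exists_restrict_ringAut
    ((MulSemiringAction.toRingAut (K ≃ₐ[k] K) K).comp G.subtype) (genMap_injective π (k := k) (K := K))
    hVG
  have hψC : ∀ (g : G) (r : R), ψ g (algebraMap (MvPolynomial (Fin 2) R) (SpecRing π) (C r)) =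
      algebraMap (MvPolynomial (Fin 2) R) (SpecRing π) (C r) := by
    intro g r
    refine genMap_injective π (k := k) (K := K) ?_
    rw [hψ, genMap_algebraMap, polyMap_C]
    exact (g : K ≃ₐ[k] K).commutes _
  obtain ⟨τ, hτ⟩ := exists_quotient_ringAut ψ (specMap_surjective hπ) (by
    intro g a ha
    rw [specMap_eq_zero_iff hπ] at ha ⊢
    exact fun h => ha ((MulEquiv.isUnit_map (ψ g)).mp h))
  have hτF : ∀ (g : G) (c : F), τ g (algebraMap F (FractionRing (MvPolynomial (Fin 2) F)) c) =
      algebraMap F (FractionRing (MvPolynomial (Fin 2) F)) c := by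
    intro g c
    obtain ⟨r, rfl⟩ := hπ c
    rw [IsScalarTower.algebraMap_apply F (MvPolynomial (Fin 2) F), algebraMap_eq, ← map_C,
      ← specMap_algebraMap, hτ, hψC]
  let φ : G →* (FractionRing (MvPolynomial (Fin 2) F) ≃ₐ[F] FractionRing (MvPolynomial (Fin 2) F)) :=
    MonoidHom.mk' (fun g => AlgEquiv.ofRingEquiv (f := τ g) (hτF g)) (fun g h => by
      ext z
      change τ (g * h) z = τ g (τ h z)
      rw [map_mul, RingAut.mul_apply])
  obtain ⟨N, hN, hNp⟩ := exists_finiteIndex_pow_prime_pow_eq_one_of_finite hp hpF htor φ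
  refine ⟨N, hN, fun g hg => ?_⟩
  obtain ⟨j, hj⟩ := hNp g hg
  rw [← map_pow] at hj
  have : IsNoetherianRing (SpecRing π) :=
    IsLocalization.isNoetherianRing (specIdeal π).primeCompl _ inferInstance
  obtain ⟨i, hi⟩ := exists_pow_prime_pow_eq_one (σ := ψ (g ^ p ^ j)) hp (by
      rw [← specMap_eq_zero_iff hπ, map_natCast,
        ← map_natCast (algebraMap F (FractionRing (MvPolynomial (Fin 2) F))), hpF, map_zero])
    (fun a => by
      rw [← specMap_eq_zero_iff hπ, map_sub, ← hτ, sub_eq_zero]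
      exact congrArg (fun e => e (specMap π a)) hj)
    (maximalIdeal_specRing_eq π) (by
      rintro _ ⟨r, -, rfl⟩
      rw [hψC, sub_self]
      exact zero_mem _) (ψ.isOfFinOrder (htor _))
  refine ⟨j + i, ?_⟩
  rw [← map_pow, ← pow_mul, ← pow_add] at hi
  have key : ∀ q, ((g ^ p ^ (j + i) : G) : K ≃ₐ[k] K) (polyMap R k K q) = polyMap R k K q := by
    intro q
    rw [← genMap_algebraMap π]
    exact (hψ _ _).symm.trans (by rw [hi])
  refine Subtype.ext (algEquiv_ext_rat ?_ ?_)
  · simpa [polyMap, ratX] using key (X 0)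
  · simpa [polyMap, ratY] using key (X 1)

theorem exists_genMap_eq_map_of_exists (hπ : Function.Surjective π) {s : K ≃ₐ[k] K}
    {u v wX wY : SpecRing π} (hu : genMap π k K u = s (ratX k K))
    (hv : genMap π k K v = s (ratY k K)) {N D N' D' : MvPolynomial (Fin 2) R}
    (hwX : IsUnit wX) (hwX' : genMap π k K wX = s (polyMap R k K D))
    (hX : s (polyMap R k K D) * ratX k K = s (polyMap R k K N))
    (hwY : IsUnit wY) (hwY' : genMap π k K wY = s (polyMap R k K D'))
    (hY : s (polyMap R k K D') * ratY k K = s (polyMap R k K N')) (a : SpecRing π) :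
    ∃ b, genMap π k K b = s (genMap π k K a) := by
  have hXX : polyMap R k K (X 0) = ratX k K := by simp [polyMap, ratX]
  have hYY : polyMap R k K (X 1) = ratY k K := by simp [polyMap, ratY]
  have key : ∀ {N D z : MvPolynomial (Fin 2) R} {w : SpecRing π}, IsUnit w →
      genMap π k K w = s (polyMap R k K D) →
      s (polyMap R k K D) * polyMap R k K z = s (polyMap R k K N) →
      algebraMap _ _ (map π z) ∈ IntermediateField.adjoin F {specMap π u, specMap π v} := by
    intro N D z w hw hw' h
    rw [← genMap_substMap π hu hv] at hw'
    have hw'' := genMap_injective π hw'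
    refine mem_adjoin_of_substMap_mul_eq (hw'' ▸ hw) (N := N)
      (genMap_injective π (k := k) (K := K) ?_)
    rw [map_mul, genMap_substMap π hu hv, genMap_substMap π hu hv, genMap_algebraMap, h]
  refine exists_genMap_eq_map hπ hu hv (algebraicIndependent_of_mem_adjoin ?_ ?_) a
  · have := key (z := X 0) hwX hwX' (hXX ▸ hX)
    rwa [map_X] at this
  · have := key (z := X 1) hwY hwY' (hYY ▸ hY)
    rwa [map_X] at this

end Reduction

section ResidueFields

instance isJacobsonRing_int : IsJacobsonRing ℤ := by
  rw [isJacobsonRing_iff_prime_eq]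
  intro P hP
  rcases eq_or_ne P ⊥ with rfl | h
  · refine eq_bot_iff.mpr fun x hx => ?_
    have h1 := Int.isUnit_iff.mp (Ideal.mem_jacobson_bot.mp hx x)
    have h2 := mul_self_nonneg x
    exact mul_self_eq_zero.mp (by omega)
  · have := IsPrime.to_maximal_ideal h
    exact Ideal.jacobson_eq_self_of_isMaximal

theorem finite_quotient_of_finiteType_int {R : Type*} [CommRing R] [Algebra.FiniteType ℤ R]
    (m : Ideal R) [m.IsMaximal] : Finite (R ⧸ m) := by
  let _ := Ideal.Quotient.field m
  have hfin : Module.Finite ℤ (R ⧸ m) := finite_of_finite_type_of_isJacobsonRing ℤ (R ⧸ m)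
  obtain ⟨n, hn⟩ := CharP.exists (R ⧸ m)
  have hn0 : n ≠ 0 := by
    rintro rfl
    have h0 := CharP.charP_to_charZero (R ⧸ m)
    have h1 : IsField ℤ := isField_of_isIntegral_of_isField
      (FaithfulSMul.algebraMap_injective ℤ (R ⧸ m)) (Field.toIsField (R ⧸ m))
    exact Int.not_isField h1
  refine Module.finite_of_fg_torsion (R ⧸ m) fun {x} => ?_
  refine ⟨⟨n, by simpa using hn0⟩, ?_⟩
  change (n : ℤ) • x = 0
  simp

theorem exists_isMaximal_notMem {R : Type*} [CommRing R] [IsDomain R] [Algebra.FiniteType ℤ R]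
    {a : R} (ha : a ≠ 0) : ∃ m : Ideal R, m.IsMaximal ∧ a ∉ m := by
  have hJ : IsJacobsonRing R := isJacobsonRing_of_finiteType (A := ℤ)
  have h1 : a ∉ (⊥ : Ideal R).jacobson := by
    rw [hJ.out (Ideal.isPrime_bot (α := R)).isRadical]
    exact ha
  rw [Ideal.jacobson, Ideal.mem_sInf] at h1
  push Not at h1
  obtain ⟨m, ⟨-, hm⟩, h⟩ := h1
  exact ⟨m, hm, h⟩

theorem exists_prime_natCast_mem {R : Type*} [CommRing R] [Algebra.FiniteType ℤ R]
    (m : Ideal R) [m.IsMaximal] : ∃ p : ℕ, p.Prime ∧ (p : R) ∈ m := by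
  have := finite_quotient_of_finiteType_int m
  let _ := Ideal.Quotient.field m
  obtain ⟨p, hp⟩ := CharP.exists (R ⧸ m)
  refine ⟨p, (CharP.char_is_prime_or_zero (R ⧸ m) p).resolve_right ?_, ?_⟩
  · exact CharP.char_ne_zero_of_finite (R ⧸ m) p
  · rw [← Ideal.Quotient.eq_zero_iff_mem, map_natCast, CharP.cast_eq_zero]

end ResidueFields

section Coefficients

open MvPolynomial

theorem exists_subalgebra_fg_coeff {σ k : Type*} [Field k] (𝓕 : Finset (MvPolynomial σ k))
    (h0 : 0 ∉ 𝓕) : ∃ (R : Subalgebra ℤ k) (a : R), R.FG ∧ a ≠ 0 ∧ ∀ f ∈ 𝓕,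
      ∃ f' : MvPolynomial σ R, map (algebraMap R k) f' = f ∧ ∃ m, coeff m f' ∣ a := by
  classical
  let T : Finset k := 𝓕.biUnion coeffs
  let R := Algebra.adjoin ℤ (T : Set k)
  have hlift : ∀ f : 𝓕, ∃ f' : MvPolynomial σ R, map (algebraMap R k) f' = f := by
    intro f
    refine mem_range_map_iff_coeffs_subset.mpr fun c hc => ?_
    exact ⟨⟨c, Algebra.subset_adjoin (Finset.mem_biUnion.mpr ⟨f, f.2, hc⟩)⟩, rfl⟩
  choose L hL using hlift
  have hL0 : ∀ f, L f ≠ 0 := by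
    intro f hf
    have := hL f
    rw [hf, map_zero] at this
    exact h0 (this ▸ f.2)
  choose m hm using fun f => ne_zero_iff.mp (hL0 f)
  exact ⟨R, ∏ f, coeff (m f) (L f), ⟨T, rfl⟩, Finset.prod_ne_zero_iff.mpr fun f _ => hm f,
    fun f hf => ⟨L ⟨f, hf⟩, hL _, m ⟨f, hf⟩, Finset.dvd_prod_of_mem _ (Finset.mem_univ _)⟩⟩

end Coefficients

section Conclusion

open MvPolynomial

theorem exists_genMap_eq_map_of_num_den {R F k K : Type*} [CommRing R] [Field F] {π : R →+* F}
    [Field k] [Field K] [Algebra (MvPolynomial (Fin 2) k) K]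
    [IsFractionRing (MvPolynomial (Fin 2) k) K] [Algebra k K]
    [IsScalarTower k (MvPolynomial (Fin 2) k) K] [Algebra R k] [FaithfulSMul R k]
    (hπ : Function.Surjective π) (s : K ≃ₐ[k] K) {n d : K → MvPolynomial (Fin 2) k}
    (hd : ∀ z, d z ≠ 0) (hnd : ∀ z, algebraMap _ K (n z) / algebraMap _ K (d z) = z)
    (hgood : ∀ z ∈ ({s (ratX k K), s (ratY k K), s⁻¹ (ratX k K), s⁻¹ (ratY k K),
      s (algebraMap _ K (d (s⁻¹ (ratX k K)))), s (algebraMap _ K (d (s⁻¹ (ratY k K))))} : Set K),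
      ∀ f ∈ ({n z, d z} : Set (MvPolynomial (Fin 2) k)),
        ∃ f' : MvPolynomial (Fin 2) R, map (algebraMap R k) f' = f ∧ map π f' ≠ 0)
    (a : SpecRing π) : ∃ b, genMap π k K b = s (genMap π k K a) := by
  have key : ∀ z ∈ ({s (ratX k K), s (ratY k K), s⁻¹ (ratX k K), s⁻¹ (ratY k K),
      s (algebraMap _ K (d (s⁻¹ (ratX k K)))), s (algebraMap _ K (d (s⁻¹ (ratY k K))))} : Set K),
      ∃ w, IsUnit w ∧ genMap π k K w = z := by
    intro z hz
    obtain ⟨f, hf, hf0⟩ := hgood z hz (n z) (by simp)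
    obtain ⟨g, hg, hg0⟩ := hgood z hz (d z) (by simp)
    obtain ⟨w, hw, hw'⟩ := exists_isUnit_genMap_eq_div (k := k) (K := K) π hf0 hg0
    refine ⟨w, hw, ?_⟩
    rw [hw', polyMap, RingHom.comp_apply, RingHom.comp_apply, hf, hg, hnd]
  have hfrac : ∀ t : K, ∀ N D : MvPolynomial (Fin 2) R, map (algebraMap R k) N = n (s⁻¹ t) →
      map (algebraMap R k) D = d (s⁻¹ t) →
      s (polyMap R k K D) * t = s (polyMap R k K N) := by
    intro t N D hN hD
    have h1 : s (s⁻¹ t) = t := s.apply_symm_apply t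
    nth_rw 1 [← h1]
    rw [← map_mul, polyMap, RingHom.comp_apply, RingHom.comp_apply, hN, hD]
    nth_rw 2 [← hnd (s⁻¹ t)]
    rw [mul_div_cancel₀]
    rw [map_ne_zero_iff _ (IsFractionRing.injective _ _)]
    exact hd _
  obtain ⟨u, -, hu⟩ := key (s (ratX k K)) (by simp)
  obtain ⟨v, -, hv⟩ := key (s (ratY k K)) (by simp)
  obtain ⟨wX, hwX, hwX'⟩ := key (s (algebraMap _ K (d (s⁻¹ (ratX k K))))) (by simp)
  obtain ⟨wY, hwY, hwY'⟩ := key (s (algebraMap _ K (d (s⁻¹ (ratY k K))))) (by simp)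
  obtain ⟨N, hN, -⟩ := hgood (s⁻¹ (ratX k K)) (by simp)
    (n (s⁻¹ (ratX k K))) (by simp)
  obtain ⟨D, hD, -⟩ := hgood (s⁻¹ (ratX k K)) (by simp)
    (d (s⁻¹ (ratX k K))) (by simp)
  obtain ⟨N', hN', -⟩ := hgood (s⁻¹ (ratY k K)) (by simp)
    (n (s⁻¹ (ratY k K))) (by simp)
  obtain ⟨D', hD', -⟩ := hgood (s⁻¹ (ratY k K)) (by simp)
    (d (s⁻¹ (ratY k K))) (by simp)
  exact exists_genMap_eq_map_of_exists hπ hu hv hwX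
    (by rw [hwX', polyMap, RingHom.comp_apply, hD]) (hfrac _ N D hN hD) hwY
    (by rw [hwY', polyMap, RingHom.comp_apply, hD']) (hfrac _ N' D' hN' hD') a

theorem exists_subalgebra_forall_genMap {k K : Type*}
    [Field k] [Field K] [Algebra (MvPolynomial (Fin 2) k) K]
    [IsFractionRing (MvPolynomial (Fin 2) k) K] [Algebra k K]
    [IsScalarTower k (MvPolynomial (Fin 2) k) K] (S : Finset (K ≃ₐ[k] K)) :
    ∃ (R : Subalgebra ℤ k) (a : R), R.FG ∧ a ≠ 0 ∧
      ∀ {F : Type _} [Field F] (π : R →+* F), Function.Surjective π → π a ≠ 0 →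
        ∀ s ∈ S, ∀ b, ∃ c, genMap π k K c = s (genMap π k K b) := by
  classical
  have hfrac : ∀ z : K, ∃ n d : MvPolynomial (Fin 2) k, d ≠ 0 ∧
      algebraMap _ K n / algebraMap _ K d = z := by
    intro z
    obtain ⟨n, d, hd, h⟩ := IsFractionRing.div_surjective (A := MvPolynomial (Fin 2) k) z
    exact ⟨n, d, nonZeroDivisors.ne_zero hd, h⟩
  choose n d hd hnd using hfrac
  let T : (K ≃ₐ[k] K) → Finset K := fun s =>
    {s (ratX k K), s (ratY k K), s⁻¹ (ratX k K), s⁻¹ (ratY k K),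
      s (algebraMap _ K (d (s⁻¹ (ratX k K)))), s (algebraMap _ K (d (s⁻¹ (ratY k K))))}
  have hT : ∀ s, ∀ z ∈ T s, z ≠ 0 := by
    intro s z hz
    simp only [T, Finset.mem_insert, Finset.mem_singleton] at hz
    have hinj := IsFractionRing.injective (MvPolynomial (Fin 2) k) K
    rcases hz with rfl | rfl | rfl | rfl | rfl | rfl <;>
      simp [ratX_ne_zero, ratY_ne_zero, map_eq_zero_iff _ hinj, hd]
  obtain ⟨R, a, hR, ha, h⟩ := exists_subalgebra_fg_coeff
    (S.biUnion fun s => (T s).biUnion fun z => {n z, d z}) (by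
      intro h
      simp only [Finset.mem_biUnion, Finset.mem_insert, Finset.mem_singleton] at h
      obtain ⟨s, -, z, hz, h | h⟩ := h
      · refine hT s z hz ?_
        rw [← hnd z, ← h, map_zero, zero_div]
      · exact hd z h.symm)
  refine ⟨R, a, hR, ha, fun {F} _ π hπ hπa s hs =>
    exists_genMap_eq_map_of_num_den hπ s hd hnd fun z hz f hf => ?_⟩
  obtain ⟨f', hf', m, hm⟩ := h f (Finset.mem_biUnion.mpr ⟨s, hs, Finset.mem_biUnion.mpr
    ⟨z, by simpa [T] using hz, by simpa using hf⟩⟩)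
  refine ⟨f', hf', fun h0 => hπa ?_⟩
  have h1 : π (coeff m f') = 0 := by rw [← coeff_map, h0, coeff_zero]
  exact zero_dvd_iff.mp (h1 ▸ map_dvd π hm)

theorem finite_of_finiteIndex_of_coprime_order {G : Type*} [Group G] {p q : ℕ}
    (hpq : Nat.Coprime p q) {N M : Subgroup G} [N.FiniteIndex] [M.FiniteIndex]
    (hN : ∀ g ∈ N, ∃ j, g ^ p ^ j = 1) (hM : ∀ g ∈ M, ∃ j, g ^ q ^ j = 1) : Finite G := by
  have hbot : N ⊓ M = ⊥ := by
    refine (Subgroup.eq_bot_iff_forall _).mpr fun g hg => ?_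
    obtain ⟨i, hi⟩ := hN g hg.1
    obtain ⟨j, hj⟩ := hM g hg.2
    exact orderOf_eq_one_iff.mp (Nat.eq_one_of_dvd_coprimes (hpq.pow i j)
      (orderOf_dvd_of_pow_eq_one hi) (orderOf_dvd_of_pow_eq_one hj))
  have h : (N ⊓ M).FiniteIndex := inferInstance
  refine Nat.finite_of_card_ne_zero ?_
  rw [← Subgroup.index_bot, ← hbot]
  exact h.index_ne_zero

end Conclusion

/-- **Burnside problem for the plane Cremona group.** Every finitely generated torsion
subgroup of `Bir(ℙ²_ℂ) = Aut_ℂ(ℂ(x,y))` is finite. -/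
theorem cremona_burnside (G : Subgroup Cremona2) (hfg : Group.FG ↥G)
    (htor : ∀ g : ↥G, IsOfFinOrder g) : Finite ↥G := by
  classical
  obtain ⟨S, hS⟩ := (Group.fg_iff_monoid_fg.mp hfg).fg_top
  obtain ⟨R, a, hR, ha, h⟩ := exists_subalgebra_forall_genMap (S.image G.subtype)
  have hRfin : Algebra.FiniteType ℤ R := R.fg_iff_finiteType.mp hR
  have hRnoeth : IsNoetherianRing R := Algebra.FiniteType.isNoetherianRing ℤ R
  have key : ∀ m : Ideal R, m.IsMaximal → a ∉ m → ∀ p : ℕ, p.Prime → (p : R) ∈ m →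
      ∃ N : Subgroup G, N.FiniteIndex ∧ ∀ g ∈ N, ∃ j, g ^ p ^ j = 1 := by
    intro m hm ham p hp hpm
    let _ := Ideal.Quotient.field m
    have := finite_quotient_of_finiteType_int m
    refine exists_finiteIndex_pow_prime_pow_eq_one_of_genMap (π := Ideal.Quotient.mk m)
      Ideal.Quotient.mk_surjective hp ?_ G htor hS fun s hs => ?_
    · rw [← map_natCast (Ideal.Quotient.mk m)]
      exact Ideal.Quotient.eq_zero_iff_mem.mpr hpm
    · exact h (Ideal.Quotient.mk m) Ideal.Quotient.mk_surjective
        (mt Ideal.Quotient.eq_zero_iff_mem.mp ham) s (Finset.mem_image_of_mem _ hs)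
  obtain ⟨m, hm, ham⟩ := exists_isMaximal_notMem ha
  obtain ⟨p, hp, hpm⟩ := exists_prime_natCast_mem m
  obtain ⟨m', hm', ham'⟩ := exists_isMaximal_notMem
    (mul_ne_zero ha (Nat.cast_ne_zero.mpr hp.ne_zero : (p : R) ≠ 0))
  obtain ⟨q, hq, hqm'⟩ := exists_prime_natCast_mem m'
  obtain ⟨N, hN, hNp⟩ := key m hm ham p hp hpm
  obtain ⟨M, hM, hMq⟩ := key m' hm' (fun h => ham' (m'.mul_mem_right _ h)) q hq hqm'
  refine finite_of_finiteIndex_of_coprime_order ((Nat.coprime_primes hp hq).mpr ?_) hNp hMq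
  rintro rfl
  exact ham' (m'.mul_mem_left _ hqm')
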